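/- arXiv:2404.06263 — 4 statements merged into one kernel-verified Lean document; each statement's English description precedes it below -/
import Mathlib

section
/- For every positive integer n and every pair S = (S₁,S₂) of finite sets, the space K_S(n) is the internal direct sum of K°_S(n) and the subspace spanned by the images of all single insertions; that is, setting W = Σ_{s₁∈S₁, s₂∈S₂} ω_{s₁,s₂}(K_{S∖({s₁},{s₂})}(n)), one has K_S(n) = K°_S(n) + W and K°_S(n) ∩ W = 0. -/
/-!
Statement 0: For every positive integer `n` and every pair `S = (S₁, S₂)` of finite sets,
`K_S(n)` is the internal direct sum of `K°_S(n)` and the subspace `W` spanned by the images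
of all single insertions `ω_{s₁,s₂}`.

We model `K_S(n) = H^{⊗S₁} ⊗ (H∨)^{⊗S₂}` (with `H = ℚⁿ`) via its coordinates in the
standard basis: an element is a function `((S₁ ⊕ S₂) → Fin n) → ℚ`.
-/

open scoped BigOperators

/-- `K_S(n)` in coordinates: the basis of `H^{⊗S₁} ⊗ (H∨)^{⊗S₂}` is indexed by functions
`S₁ ⊕ S₂ → Fin n`. -/
abbrev KSpace (n : ℕ) (S₁ S₂ : Type) : Type := ((S₁ ⊕ S₂) → Fin n) → ℚ

/-- The contraction `λ_{s₁,s₂} : K_S(n) → K_{S∖({s₁},{s₂})}(n)`, applying the evaluation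
pairing `H ⊗ H∨ → ℚ` to the tensor factors indexed by `s₁` and `s₂`. -/
def contraction (n : ℕ) {S₁ S₂ : Type} [DecidableEq S₁] [DecidableEq S₂]
    (s₁ : S₁) (s₂ : S₂) :
    KSpace n S₁ S₂ →ₗ[ℚ] KSpace n {x : S₁ // x ≠ s₁} {y : S₂ // y ≠ s₂} where
  toFun T := fun φ => ∑ i : Fin n, T (fun z => match z with
    | Sum.inl x => if h : x = s₁ then i else φ (Sum.inl ⟨x, h⟩)
    | Sum.inr y => if h : y = s₂ then i else φ (Sum.inr ⟨y, h⟩))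
  map_add' T T' := by
    funext φ
    simp [Finset.sum_add_distrib]
  map_smul' a T := by
    funext φ
    simp [Finset.mul_sum]

/-- The insertion `ω_{s₁,s₂} : K_{S∖({s₁},{s₂})}(n) → K_S(n)`, inserting the two legs of
`ω(1) = Σᵢ eᵢ ⊗ eᵢ#` into the tensor factors indexed by `s₁` and `s₂`. -/
def insertion (n : ℕ) {S₁ S₂ : Type} [DecidableEq S₁] [DecidableEq S₂]
    (s₁ : S₁) (s₂ : S₂) :
    KSpace n {x : S₁ // x ≠ s₁} {y : S₂ // y ≠ s₂} →ₗ[ℚ] KSpace n S₁ S₂ where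
  toFun U := fun ψ =>
    if ψ (Sum.inl s₁) = ψ (Sum.inr s₂)
    then U (fun z => match z with
      | Sum.inl x => ψ (Sum.inl x.1)
      | Sum.inr y => ψ (Sum.inr y.1))
    else 0
  map_add' U U' := by
    funext ψ
    by_cases h : ψ (Sum.inl s₁) = ψ (Sum.inr s₂) <;> simp [h]
  map_smul' a U := by
    funext ψ
    by_cases h : ψ (Sum.inl s₁) = ψ (Sum.inr s₂) <;> simp [h]

/-- `K°_S(n)`: the intersection of the kernels of all contractions. -/
def Kcirc (n : ℕ) (S₁ S₂ : Type) [DecidableEq S₁] [DecidableEq S₂] :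
    Submodule ℚ (KSpace n S₁ S₂) :=
  ⨅ (s₁ : S₁) (s₂ : S₂), LinearMap.ker (contraction n s₁ s₂)

/-- Extending an index function by the common value `i` at the two positions. -/
def extIdx (n : ℕ) {S₁ S₂ : Type} [DecidableEq S₁] [DecidableEq S₂]
    (s₁ : S₁) (s₂ : S₂) (φ : ({x : S₁ // x ≠ s₁} ⊕ {y : S₂ // y ≠ s₂}) → Fin n) (i : Fin n) :
    (S₁ ⊕ S₂) → Fin n := fun z => match z with
    | Sum.inl x => if h : x = s₁ then i else φ (Sum.inl ⟨x, h⟩)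
    | Sum.inr y => if h : y = s₂ then i else φ (Sum.inr ⟨y, h⟩)

/-- Restricting an index function. -/
def resIdx (n : ℕ) {S₁ S₂ : Type} (s₁ : S₁) (s₂ : S₂) (ψ : (S₁ ⊕ S₂) → Fin n) :
    ({x : S₁ // x ≠ s₁} ⊕ {y : S₂ // y ≠ s₂}) → Fin n := fun z => match z with
      | Sum.inl x => ψ (Sum.inl x.1)
      | Sum.inr y => ψ (Sum.inr y.1)

theorem insertion_adjoint (n : ℕ) {S₁ S₂ : Type}
    [Fintype S₁] [Fintype S₂] [DecidableEq S₁] [DecidableEq S₂] (s₁ : S₁) (s₂ : S₂)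
    (T : KSpace n S₁ S₂) (U : KSpace n {x : S₁ // x ≠ s₁} {y : S₂ // y ≠ s₂}) :
    ∑ ψ, insertion n s₁ s₂ U ψ * T ψ = ∑ φ, U φ * contraction n s₁ s₂ T φ := by
  have h1 : ∀ ψ, insertion n s₁ s₂ U ψ * T ψ = if ψ (Sum.inl s₁) = ψ (Sum.inr s₂) then
      U (resIdx n s₁ s₂ ψ) * T ψ else 0 := by
    intro ψ
    change (if _ then U (resIdx n s₁ s₂ ψ) else 0) * _ = _
    split_ifs <;> simp
  have h2 : ∀ φ, U φ * contraction n s₁ s₂ T φ = ∑ i, U φ * T (extIdx n s₁ s₂ φ i) := by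
    intro φ
    rw [← Finset.mul_sum]
    rfl
  simp_rw [h1, h2]
  rw [← Finset.sum_filter, ← Fintype.sum_prod_type']
  have e1 : ∀ ψ : (S₁ ⊕ S₂) → Fin n, ψ (Sum.inl s₁) = ψ (Sum.inr s₂) →
      extIdx n s₁ s₂ (resIdx n s₁ s₂ ψ) (ψ (Sum.inl s₁)) = ψ := by
    intro ψ h
    funext z
    rcases z with x | y
    · by_cases hx : x = s₁
      · subst hx; simp [extIdx]
      · simp [extIdx, resIdx, hx]
    · by_cases hy : y = s₂
      · subst hy; simp [extIdx, h]
      · simp [extIdx, resIdx, hy]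
  have e2 : ∀ φ i, resIdx n s₁ s₂ (extIdx n s₁ s₂ φ i) = φ := by
    intro φ i
    funext z
    rcases z with ⟨x, hx⟩ | ⟨y, hy⟩
    · simp [extIdx, resIdx, hx]
    · simp [extIdx, resIdx, hy]
  refine Finset.sum_bij' (fun ψ _ => (resIdx n s₁ s₂ ψ, ψ (Sum.inl s₁)))
    (fun p _ => extIdx n s₁ s₂ p.1 p.2) ?_ ?_ ?_ ?_ ?_
  · intro ψ _; simp
  · intro p _; simp [extIdx]
  · intro ψ h
    exact e1 ψ (Finset.mem_filter.1 h).2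
  · rintro ⟨φ, i⟩ _
    refine Prod.ext (e2 φ i) ?_
    simp [extIdx]
  · intro ψ h
    simp only [e1 ψ (Finset.mem_filter.1 h).2]

theorem statement_0 (n : ℕ) (hn : 0 < n) (S₁ S₂ : Type)
    [Fintype S₁] [Fintype S₂] [DecidableEq S₁] [DecidableEq S₂] :
    Kcirc n S₁ S₂ ⊔ (⨆ (s₁ : S₁) (s₂ : S₂), LinearMap.range (insertion n s₁ s₂)) = ⊤ ∧
    Kcirc n S₁ S₂ ⊓ (⨆ (s₁ : S₁) (s₂ : S₂), LinearMap.range (insertion n s₁ s₂)) = ⊥ := by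
  set W : Submodule ℚ (KSpace n S₁ S₂) :=
    ⨆ (s₁ : S₁) (s₂ : S₂), LinearMap.range (insertion n s₁ s₂) with hW
  let B : LinearMap.BilinForm ℚ (KSpace n S₁ S₂) := dotProductBilin ℚ ℚ
  have hB : ∀ x y, B x y = x ⬝ᵥ y := fun _ _ => rfl
  have hrefl : B.IsRefl := by
    intro x y h
    rw [hB] at *
    rwa [dotProduct_comm]
  have hK : B.orthogonal W = Kcirc n S₁ S₂ := by
    apply le_antisymm
    · intro T hT
      simp only [Kcirc, Submodule.mem_iInf, LinearMap.mem_ker]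
      intro s₁ s₂
      have h := hT (insertion n s₁ s₂ (contraction n s₁ s₂ T))
        (Submodule.mem_iSup_of_mem s₁ (Submodule.mem_iSup_of_mem s₂ ⟨_, rfl⟩))
      have h' : contraction n s₁ s₂ T ⬝ᵥ contraction n s₁ s₂ T = 0 :=
        (insertion_adjoint n s₁ s₂ T _).symm.trans h
      exact dotProduct_self_eq_zero.1 h'
    · intro T hT
      simp only [Kcirc, Submodule.mem_iInf, LinearMap.mem_ker] at hT
      have hle : W ≤ LinearMap.ker (B T) := by
        refine iSup_le fun s₁ => iSup_le fun s₂ => ?_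
        rintro _ ⟨U, rfl⟩
        rw [LinearMap.mem_ker, hB, dotProduct_comm]
        refine (insertion_adjoint n s₁ s₂ T U).trans ?_
        simp [hT]
      intro w hw
      exact hrefl _ _ (hle hw)
  have hdisj : Disjoint W (B.orthogonal W) := by
    rw [Submodule.disjoint_def]
    intro x hx hx'
    exact dotProduct_self_eq_zero.1 (hx' x hx)
  have hc := (LinearMap.BilinForm.isCompl_orthogonal_iff_disjoint hrefl).2 hdisj
  rw [hK] at hc
  exact ⟨hc.symm.sup_eq_top, hc.symm.inf_eq_bot⟩
end

section
/- For every positive integer n and every pair S = (S₁,S₂) of finite sets, let F_i = Σ_{I⊆S, |I₁|=|I₂|=i} Σ_{m ∈ M(I)} ω_m(K°_{S∖I}(n)) for 0 ≤ i ≤ min(|S₁|,|S₂|), where M(I) is the set of bipartite matchings of I. Then K_S(n) is the internal direct sum K_S(n) = F_0 ⊕ F_1 ⊕ ⋯ ⊕ F_{min(|S₁|,|S₂|)} (note F_0 = K°_S(n)). -/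
/-!
Statement 1: For every positive integer `n` and every pair `S = (S₁,S₂)` of finite sets, with
`F_i = Σ_{I⊆S, |I₁|=|I₂|=i} Σ_{m ∈ M(I)} ω_m(K°_{S∖I}(n))`, the space `K_S(n)` is the
internal direct sum `F_0 ⊕ F_1 ⊕ ⋯ ⊕ F_{min(|S₁|,|S₂|)}` (and `F_0 = K°_S(n)`).
-/

open scoped BigOperators

/-- The iterated insertion `ω_m : K_{S∖I}(n) → K_S(n)` along a bipartite matching
`m : I₁ ≃ I₂` of `I = (I₁,I₂) ⊆ S`: it inserts a copy of `ω(1) = Σᵢ eᵢ ⊗ eᵢ#` into the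
pair of tensor factors indexed by `(a, m a)` for every `a ∈ I₁`. -/
def insertMany (n : ℕ) {S₁ S₂ : Type} [DecidableEq S₁] [DecidableEq S₂]
    (I₁ : Finset S₁) (I₂ : Finset S₂) (m : ↥I₁ ≃ ↥I₂) :
    KSpace n {x : S₁ // x ∉ I₁} {y : S₂ // y ∉ I₂} →ₗ[ℚ] KSpace n S₁ S₂ where
  toFun U := fun ψ =>
    if ∀ a : ↥I₁, ψ (Sum.inl a.1) = ψ (Sum.inr (m a).1)
    then U (fun z => match z with
      | Sum.inl x => ψ (Sum.inl x.1)
      | Sum.inr y => ψ (Sum.inr y.1))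
    else 0
  map_add' U U' := by
    funext ψ
    simp only [Pi.add_apply]
    split_ifs <;> simp
  map_smul' a U := by
    funext ψ
    simp only [Pi.smul_apply, smul_eq_mul, RingHom.id_apply]
    split_ifs <;> simp

/-- `F_i = Σ_{I⊆S, |I₁|=|I₂|=i} Σ_{m ∈ M(I)} ω_m(K°_{S∖I}(n))`. -/
def Fpiece (n : ℕ) (S₁ S₂ : Type) [DecidableEq S₁] [DecidableEq S₂] (i : ℕ) :
    Submodule ℚ (KSpace n S₁ S₂) :=
  ⨆ (I₁ : Finset S₁) (I₂ : Finset S₂) (_ : I₁.card = i) (_ : I₂.card = i)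
    (m : ↥I₁ ≃ ↥I₂),
      Submodule.map (insertMany n I₁ I₂ m)
        (Kcirc n {x : S₁ // x ∉ I₁} {y : S₂ // y ∉ I₂})

def IsMt {α β : Type} (M : Finset (α × β)) : Prop :=
  (∀ p ∈ M, ∀ q ∈ M, p.1 = q.1 → p = q) ∧ (∀ p ∈ M, ∀ q ∈ M, p.2 = q.2 → p = q)

/-- Augmenting component data. -/
def Aug {α β : Type} (X : Type) (M M' : Finset (α × β)) : Prop :=
  ∃ (C₁ : α → Prop) (C₂ : β → Prop) (s : α) (t : β),
    C₁ s ∧ C₂ t ∧ (∀ b, (s, b) ∉ M) ∧ (∀ a, (a, t) ∉ M) ∧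
    (∀ a b, (a, b) ∈ M → (C₁ a ↔ C₂ b)) ∧
    (∀ a b, (a, b) ∈ M' → (C₁ a ↔ C₂ b)) ∧
    (∀ a, C₁ a → a ≠ s → ∃ b, (a, b) ∈ M) ∧
    (∀ b, C₂ b → b ≠ t → ∃ a, (a, b) ∈ M) ∧
    (∀ a, C₁ a → ∃ b, (a, b) ∈ M') ∧
    (∀ b, C₂ b → ∃ a, (a, b) ∈ M') ∧
    (∀ (f : α → X) (g : β → X), (∀ a b, (a, b) ∈ M → f a = g b) →
      (∀ a b, (a, b) ∈ M' → f a = g b) → f s = g t)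

theorem aug_exists {α β : Type} [DecidableEq α] [DecidableEq β] (X : Type) :
    ∀ (k : ℕ) (M M' : Finset (α × β)), M.card = k → IsMt M → IsMt M' → M.card < M'.card →
      Aug X M M' := by
  intro k
  induction k with
  | zero =>
    intro M M' hk hM hM' hlt
    obtain ⟨⟨s, t⟩, hst⟩ := Finset.card_pos.mp (by omega : 0 < M'.card)
    have h0 : M = ∅ := Finset.card_eq_zero.mp hk
    subst h0
    obtain ⟨h1, h2⟩ := hM'
    refine ⟨fun a => a = s, fun b => b = t, s, t, rfl, rfl, by simp, by simp, by simp, ?_, ?_, ?_, ?_, ?_, ?_⟩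
    · intro a b hab
      constructor
      · rintro rfl
        have := h1 _ hab _ hst rfl
        grind
      · rintro rfl
        have := h2 _ hab _ hst rfl
        grind
    all_goals grind
  | succ k ih =>
    intro M M' hk hM hM' hlt
    obtain ⟨h1, h2⟩ := hM
    obtain ⟨h1', h2'⟩ := hM'
    have key : ∃ s₀ t₀, (s₀, t₀) ∈ M' ∧ ∀ b, (s₀, b) ∉ M := by
      by_contra hcon
      push Not at hcon
      have : (M'.image Prod.fst).card ≤ (M.image Prod.fst).card := by
        apply Finset.card_le_card
        intro a ha
        simp only [Finset.mem_image, Prod.exists, exists_and_right, exists_eq_right] at ha ⊢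
        obtain ⟨b, hb⟩ := ha
        exact hcon a b hb
      rw [Finset.card_image_of_injOn (fun p hp q hq h => h1' p hp q hq h)] at this
      have h3 : (M.image Prod.fst).card ≤ M.card := Finset.card_image_le
      omega
    obtain ⟨s₀, t₀, hst, hs₀⟩ := key
    by_cases ht : ∀ a, (a, t₀) ∉ M
    · refine ⟨fun a => a = s₀, fun b => b = t₀, s₀, t₀, rfl, rfl, hs₀, ht, by grind, ?_, ?_, ?_, ?_, ?_, ?_⟩
      · intro a b hab
        constructor
        · rintro rfl
          have := h1' _ hab _ hst rfl
          grind
        · rintro rfl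
          have := h2' _ hab _ hst rfl
          grind
      all_goals grind
    push Not at ht
    obtain ⟨s₁, hs₁⟩ := ht
    have hne : s₁ ≠ s₀ := by rintro rfl; exact hs₀ _ hs₁
    have hMc : (M.erase (s₁, t₀)).card = k := by rw [Finset.card_erase_of_mem hs₁]; omega
    have hMm : IsMt (M.erase (s₁, t₀)) := by
      constructor
      · intro p hp q hq; exact h1 p (Finset.mem_of_mem_erase hp) q (Finset.mem_of_mem_erase hq)
      · intro p hp q hq; exact h2 p (Finset.mem_of_mem_erase hp) q (Finset.mem_of_mem_erase hq)
    have u1 : ∀ b, (s₁, b) ∈ M → b = t₀ := fun b hb => by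
      have := h1 _ hb _ hs₁ rfl; grind
    have u2 : ∀ a, (a, t₀) ∈ M → a = s₁ := fun b hb => by
      have := h2 _ hb _ hs₁ rfl; grind
    have u3 : ∀ b, (s₀, b) ∈ M' → b = t₀ := fun b hb => by
      have := h1' _ hb _ hst rfl; grind
    have u4 : ∀ a, (a, t₀) ∈ M' → a = s₀ := fun b hb => by
      have := h2' _ hb _ hst rfl; grind
    by_cases hs : ∃ t₁, (s₁, t₁) ∈ M'
    · obtain ⟨t₁, ht₁⟩ := hs
      have hne2 : t₁ ≠ t₀ := by rintro rfl; exact hne (u4 _ ht₁)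
      have u5 : ∀ b, (s₁, b) ∈ M' → b = t₁ := fun b hb => by
        have := h1' _ hb _ ht₁ rfl; grind
      have u6 : ∀ a, (a, t₁) ∈ M' → a = s₁ := fun b hb => by
        have := h2' _ hb _ ht₁ rfl; grind
      set N' := insert (s₀, t₁) ((M'.erase (s₀, t₀)).erase (s₁, t₁)) with hN'
      have mN : ∀ a b, (a, b) ∈ N' ↔ (a = s₀ ∧ b = t₁) ∨ ((a, b) ∈ M' ∧ a ≠ s₀ ∧ a ≠ s₁) := by
        intro a b
        simp only [hN', Finset.mem_insert, Finset.mem_erase, Prod.mk.injEq, ne_eq]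
        grind
      have mE : ∀ a b, (a, b) ∈ M.erase (s₁, t₀) ↔ ((a, b) ∈ M ∧ a ≠ s₁) := by
        intro a b
        simp only [Finset.mem_erase, Prod.mk.injEq, ne_eq]
        grind
      have hNm : IsMt N' := by
        constructor
        · rintro ⟨a, b⟩ hp ⟨a', b'⟩ hq h
          rw [mN] at hp hq
          simp only at h
          subst h
          rcases hp with hp | hp <;> rcases hq with hq | hq
          · grind
          · grind
          · grind
          · exact h1' _ hp.1 _ hq.1 rfl
        · rintro ⟨a, b⟩ hp ⟨a', b'⟩ hq h
          rw [mN] at hp hq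
          simp only at h
          subst h
          rcases hp with hp | hp <;> rcases hq with hq | hq
          · grind
          · grind
          · grind
          · exact h2' _ hp.1 _ hq.1 rfl
      have hNc : M'.card = N'.card + 1 := by
        have e1 := Finset.card_erase_of_mem hst
        have e2 := Finset.card_erase_of_mem (show (s₁, t₁) ∈ M'.erase (s₀, t₀) by grind)
        have e3 : (s₀, t₁) ∉ (M'.erase (s₀, t₀)).erase (s₁, t₁) := by grind
        rw [hN', Finset.card_insert_of_notMem e3]
        omega
      obtain ⟨C₁, C₂, s, t, a1, a2, a3, a4, a5, a6, a7, a8, a9, a10, a11⟩ :=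
        ih _ N' hMc hMm hNm (by omega)
      simp only [mN, mE] at a3 a4 a5 a6 a7 a8 a9 a10 a11
      clear ih h1 h2 h1' h2' hNm hNc hMm hMc mN mE hk hlt
      clear hN'
      clear_value N'
      clear N'
      have c1 : ¬ C₁ s₁ := by grind
      have c2 : ¬ C₂ t₀ := by grind
      have c3 : C₁ s₀ ↔ C₂ t₁ := a6 _ _ (Or.inl ⟨rfl, rfl⟩)
      refine ⟨fun a => C₁ a ∨ (a = s₁ ∧ C₁ s₀), fun b => C₂ b ∨ (b = t₀ ∧ C₁ s₀), s, t,
        Or.inl a1, Or.inl a2, ?_, ?_, ?_, ?_, ?_, ?_, ?_, ?_, ?_⟩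
      · grind
      · grind
      · grind
      · grind
      · rintro a (ha | ⟨rfl, ha⟩) hne3
        · obtain ⟨b, hb, -⟩ := a7 a ha hne3
          exact ⟨b, hb⟩
        · exact ⟨_, hs₁⟩
      · rintro a (ha | ⟨rfl, ha⟩) hne3
        · obtain ⟨b, hb, -⟩ := a8 a ha hne3
          exact ⟨b, hb⟩
        · exact ⟨_, hs₁⟩
      · rintro a (ha | ⟨rfl, ha⟩)
        · obtain ⟨b, ⟨rfl, rfl⟩ | hb⟩ := a9 a ha
          · exact ⟨_, hst⟩
          · exact ⟨b, hb.1⟩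
        · exact ⟨_, ht₁⟩
      · rintro a (ha | ⟨rfl, ha⟩)
        · obtain ⟨b, ⟨rfl, rfl⟩ | hb⟩ := a10 a ha
          · exact ⟨_, ht₁⟩
          · exact ⟨b, hb.1⟩
        · exact ⟨_, hst⟩
      · intro f g hf hg
        apply a11 f g
        · intro a b hab
          exact hf a b hab.1
        · rintro a b (⟨rfl, rfl⟩ | hab)
          · rw [hg _ _ hst, ← hf _ _ hs₁, hg _ _ ht₁]
          · exact hg a b hab.1
    · push Not at hs
      set N' := M'.erase (s₀, t₀) with hN'
      have mN : ∀ a b, (a, b) ∈ N' ↔ ((a, b) ∈ M' ∧ a ≠ s₀) := by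
        intro a b
        simp only [hN', Finset.mem_erase, Prod.mk.injEq, ne_eq]
        grind
      have mE : ∀ a b, (a, b) ∈ M.erase (s₁, t₀) ↔ ((a, b) ∈ M ∧ a ≠ s₁) := by
        intro a b
        simp only [Finset.mem_erase, Prod.mk.injEq, ne_eq]
        grind
      have hNm : IsMt N' := by
        constructor
        · intro p hp q hq; exact h1' p (Finset.mem_of_mem_erase hp) q (Finset.mem_of_mem_erase hq)
        · intro p hp q hq; exact h2' p (Finset.mem_of_mem_erase hp) q (Finset.mem_of_mem_erase hq)
      have hNc : N'.card = M'.card - 1 := Finset.card_erase_of_mem hst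
      obtain ⟨C₁, C₂, s, t, a1, a2, a3, a4, a5, a6, a7, a8, a9, a10, a11⟩ :=
        ih _ N' hMc hMm hNm (by omega)
      simp only [mN, mE] at a3 a4 a5 a6 a7 a8 a9 a10 a11
      clear ih h1 h2 h1' h2' hNm hNc hMm hMc mN mE hk hlt
      clear hN'
      clear_value N'
      clear N'
      have c1 : ¬ C₁ s₁ := by grind
      have c2 : ¬ C₂ t₀ := by grind
      have c4 : ¬ C₁ s₀ := by grind
      refine ⟨C₁, C₂, s, t, a1, a2, ?_, ?_, ?_, ?_, ?_, ?_, ?_, ?_, ?_⟩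
      · grind
      · grind
      · grind
      · grind
      · intro a ha hne3
        obtain ⟨b, hb, -⟩ := a7 a ha hne3
        exact ⟨b, hb⟩
      · intro a ha hne3
        obtain ⟨b, hb, -⟩ := a8 a ha hne3
        exact ⟨b, hb⟩
      · intro a ha
        obtain ⟨b, hb, -⟩ := a9 a ha
        exact ⟨b, hb⟩
      · intro a ha
        obtain ⟨b, hb, -⟩ := a10 a ha
        exact ⟨b, hb⟩
      · intro f g hf hg
        exact a11 f g (fun a b hab => hf a b hab.1) (fun a b hab => hg a b hab.1)

/-- Overwrite the coordinates `s`, `t` by `i`. -/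
def upd {n : ℕ} {S₁ S₂ : Type} [DecidableEq S₁] [DecidableEq S₂] (s : S₁) (t : S₂) (i : Fin n)
    (ψ : S₁ ⊕ S₂ → Fin n) : S₁ ⊕ S₂ → Fin n := fun z => match z with
  | Sum.inl x => if x = s then i else ψ (Sum.inl x)
  | Sum.inr y => if y = t then i else ψ (Sum.inr y)

def Cmp {n : ℕ} {S₁ S₂ : Type} (M : Finset (S₁ × S₂)) (ψ : S₁ ⊕ S₂ → Fin n) : Prop :=
  ∀ a b, (a, b) ∈ M → ψ (Sum.inl a) = ψ (Sum.inr b)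

/-- `A` does not depend on the coordinates in `M`. -/
def Dep {n : ℕ} {S₁ S₂ : Type} (M : Finset (S₁ × S₂)) (A : KSpace n S₁ S₂) : Prop :=
  ∀ ψ ψ' : S₁ ⊕ S₂ → Fin n, (∀ a, (∀ b, (a, b) ∉ M) → ψ (Sum.inl a) = ψ' (Sum.inl a)) →
    (∀ b, (∀ a, (a, b) ∉ M) → ψ (Sum.inr b) = ψ' (Sum.inr b)) → A ψ = A ψ'

/-- `A` is traceless outside `M`. -/
def Trl {n : ℕ} {S₁ S₂ : Type} [DecidableEq S₁] [DecidableEq S₂] (M : Finset (S₁ × S₂))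
    (A : KSpace n S₁ S₂) : Prop :=
  ∀ s t, (∀ b, (s, b) ∉ M) → (∀ a, (a, t) ∉ M) → ∀ ψ, ∑ i : Fin n, A (upd s t i ψ) = 0

open Classical in
noncomputable def ins {n : ℕ} {S₁ S₂ : Type} (M : Finset (S₁ × S₂)) :
    KSpace n S₁ S₂ →ₗ[ℚ] KSpace n S₁ S₂ where
  toFun A := fun ψ => if Cmp M ψ then A ψ else 0
  map_add' U U' := by
    funext ψ
    simp only [Pi.add_apply]
    split_ifs <;> simp
  map_smul' a U := by
    funext ψ
    simp only [Pi.smul_apply, smul_eq_mul, RingHom.id_apply]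
    split_ifs <;> simp

open Classical in
theorem ins_apply {n : ℕ} {S₁ S₂ : Type} (M : Finset (S₁ × S₂)) (A : KSpace n S₁ S₂) (ψ) :
    ins M A ψ = if Cmp M ψ then A ψ else 0 := rfl

open Classical in
noncomputable def shf {n : ℕ} [NeZero n] {ι : Type} (C : ι → Prop) (k : Fin n)
    (ψ : ι → Fin n) : ι → Fin n := fun z => if C z then ψ z + k else ψ z

theorem shf_sum {n : ℕ} [NeZero n] {ι : Type} [Fintype ι] [DecidableEq ι] (C : ι → Prop)
    (f : (ι → Fin n) → ℚ) :
    ∑ ψ : ι → Fin n, ∑ k : Fin n, f (shf C k ψ) = n * ∑ ψ : ι → Fin n, f ψ := by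
  classical
  rw [Finset.sum_comm]
  have : ∀ k : Fin n, ∑ ψ : ι → Fin n, f (shf C k ψ) = ∑ ψ : ι → Fin n, f ψ := by
    intro k
    apply Finset.sum_nbij' (fun ψ => shf C k ψ) (fun ψ => shf C (-k) ψ)
    · simp
    · simp
    · intro ψ _
      funext z
      simp only [shf]
      split_ifs <;> simp
    · intro ψ _
      funext z
      simp only [shf]
      split_ifs <;> simp
    · intro ψ _
      rfl
  simp [this]

theorem shf_sum_zero {n : ℕ} [NeZero n] {ι : Type} [Fintype ι] [DecidableEq ι] (C : ι → Prop)
    (f : (ι → Fin n) → ℚ) (h : ∀ ψ, ∑ k : Fin n, f (shf C k ψ) = 0) :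
    ∑ ψ : ι → Fin n, f ψ = 0 := by
  have h1 := shf_sum C f
  simp only [h, Finset.sum_const_zero] at h1
  have h2 : (n : ℚ) ≠ 0 := by exact_mod_cast NeZero.ne n
  rcases mul_eq_zero.mp h1.symm with h3 | h3
  · exact absurd h3 h2
  · exact h3

theorem cmp_shf {n : ℕ} [NeZero n] {S₁ S₂ : Type} {M : Finset (S₁ × S₂)} {C₁ : S₁ → Prop}
    {C₂ : S₂ → Prop} (h : ∀ a b, (a, b) ∈ M → (C₁ a ↔ C₂ b)) (k : Fin n) (ψ) :
    Cmp M (shf (Sum.elim C₁ C₂) k ψ) ↔ Cmp M ψ := by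
  unfold Cmp
  refine forall_congr' fun a => forall_congr' fun b => forall_congr' fun hab => ?_
  have := h a b hab
  by_cases hc : C₂ b
  · simp [shf, this.mpr hc, hc]
  · simp [shf, mt this.mp hc, hc]

/-- the basic orthogonality -/
theorem ins_orth {n : ℕ} [NeZero n] {S₁ S₂ : Type} [Fintype S₁] [Fintype S₂] [DecidableEq S₁]
    [DecidableEq S₂] {M M' : Finset (S₁ × S₂)} (hM : IsMt M) (hM' : IsMt M')
    (hlt : M.card < M'.card) {A B : KSpace n S₁ S₂} (hA : Dep M A) (hA' : Trl M A)
    (hB : Dep M' B) : ∑ ψ, ins M A ψ * ins M' B ψ = 0 := by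
  classical
  obtain ⟨C₁, C₂, s, t, a1, a2, a3, a4, a5, a6, a7, a8, a9, a10, a11⟩ :=
    aug_exists (Fin n) _ M M' rfl hM hM' hlt
  apply shf_sum_zero (Sum.elim C₁ C₂)
  intro ψ
  simp only [ins_apply, cmp_shf a5, cmp_shf a6]
  by_cases h : Cmp M ψ
  swap
  · simp [h]
  by_cases h' : Cmp M' ψ
  swap
  · simp [h']
  simp only [h, h', if_true]
  have hst : ψ (Sum.inl s) = ψ (Sum.inr t) :=
    a11 (fun a => ψ (Sum.inl a)) (fun b => ψ (Sum.inr b)) h h'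
  have e1 : ∀ k, B (shf (Sum.elim C₁ C₂) k ψ) = B ψ := by
    intro k
    apply hB
    · intro a ha
      have : ¬ C₁ a := fun hc => by obtain ⟨b, hb⟩ := a9 a hc; exact ha b hb
      simp [shf, this]
    · intro b hb
      have : ¬ C₂ b := fun hc => by obtain ⟨a, ha⟩ := a10 b hc; exact hb a ha
      simp [shf, this]
  have e2 : ∀ k, A (shf (Sum.elim C₁ C₂) k ψ) = A (upd s t (ψ (Sum.inl s) + k) ψ) := by
    intro k
    apply hA
    · intro a ha
      by_cases has : a = s
      · subst has
        simp [shf, upd, a1]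
      · have : ¬ C₁ a := fun hc => by obtain ⟨b, hb⟩ := a7 a hc has; exact ha b hb
        simp [shf, upd, this, has]
    · intro b hb
      by_cases hbt : b = t
      · subst hbt
        simp [shf, upd, a2, hst]
      · have : ¬ C₂ b := fun hc => by obtain ⟨a, ha⟩ := a8 b hc hbt; exact hb a ha
        simp [shf, upd, this, hbt]
  simp only [e1, e2]
  rw [← Finset.sum_mul]
  have e3 : ∑ k, A (upd s t (ψ (Sum.inl s) + k) ψ) = ∑ k, A (upd s t k ψ) :=
    Equiv.sum_comp (Equiv.addLeft (ψ (Sum.inl s))) (fun k => A (upd s t k ψ))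
  rw [e3, hA' s t a3 a4, zero_mul]

/-- reformulated pieces -/
def Gset (n : ℕ) (S₁ S₂ : Type) [DecidableEq S₁] [DecidableEq S₂] (i : ℕ) :
    Set (KSpace n S₁ S₂) :=
  {T | ∃ M A, IsMt M ∧ M.card = i ∧ Dep M A ∧ Trl M A ∧ T = ins M A}

def Gp (n : ℕ) (S₁ S₂ : Type) [DecidableEq S₁] [DecidableEq S₂] (i : ℕ) :
    Submodule ℚ (KSpace n S₁ S₂) := Submodule.span ℚ (Gset n S₁ S₂ i)

theorem Gp_orth {n : ℕ} [NeZero n] {S₁ S₂ : Type} [Fintype S₁] [Fintype S₂] [DecidableEq S₁]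
    [DecidableEq S₂] {i j : ℕ} (hij : i ≠ j) {u v : KSpace n S₁ S₂} (hu : u ∈ Gp n S₁ S₂ i)
    (hv : v ∈ Gp n S₁ S₂ j) : u ⬝ᵥ v = 0 := by
  unfold Gp at hu hv
  induction hu using Submodule.span_induction with
  | zero => simp
  | add x y _ _ hx hy => rw [add_dotProduct, hx, hy, add_zero]
  | smul c x _ hx => rw [smul_dotProduct, hx, smul_zero]
  | mem x hx =>
    induction hv using Submodule.span_induction with
    | zero => simp
    | add x y _ _ hx hy => rw [dotProduct_add, hx, hy, add_zero]
    | smul c x _ hx => rw [dotProduct_smul, hx, smul_zero]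
    | mem y hy =>
      obtain ⟨M, A, h1, h2, h3, h4, rfl⟩ := hx
      obtain ⟨M', A', h1', h2', h3', h4', rfl⟩ := hy
      rcases lt_or_gt_of_ne hij with h | h
      · exact ins_orth h1 h1' (by omega) h3 h4 h3'
      · rw [dotProduct_comm]
        exact ins_orth h1' h1 (by omega) h3' h4' h3

theorem Gp_indep {n : ℕ} [NeZero n] {S₁ S₂ : Type} [Fintype S₁] [Fintype S₂] [DecidableEq S₁]
    [DecidableEq S₂] (m : ℕ) : iSupIndep (fun i : Fin m => Gp n S₁ S₂ i.val) := by
  intro i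
  rw [Submodule.disjoint_def]
  intro u hu hv
  have key : ∀ w ∈ Gp n S₁ S₂ i.val, ∀ v ∈ (⨆ j, ⨆ (_ : j ≠ i), Gp n S₁ S₂ (j : Fin m).val),
      w ⬝ᵥ v = 0 := by
    intro w hw v hv
    have : (⨆ j, ⨆ (_ : j ≠ i), Gp n S₁ S₂ (j : Fin m).val) ≤
        LinearMap.ker (dotProductBilin ℚ ℚ w) := by
      refine iSup_le fun j => iSup_le fun hj => ?_
      intro x hx
      rw [LinearMap.mem_ker]
      exact Gp_orth (fun h => hj (Fin.ext h.symm)) hw hx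
    exact this hv
  exact dotProduct_self_eq_zero.mp (key u hu u hv)

theorem exists_orth {ι : Type} [Fintype ι] (W : Submodule ℚ (ι → ℚ)) (a : ι → ℚ) :
    ∃ w ∈ W, ∀ v ∈ W, v ⬝ᵥ (a - w) = 0 := by
  set B : LinearMap.BilinForm ℚ (ι → ℚ) := dotProductBilin ℚ ℚ with hB
  have hr : B.IsRefl := by
    intro x y h
    change y ⬝ᵥ x = 0
    rw [dotProduct_comm]
    exact h
  have hc : IsCompl W (B.orthogonal W) := by
    rw [LinearMap.BilinForm.isCompl_orthogonal_iff_disjoint hr, Submodule.disjoint_def]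
    intro x hx hx'
    exact dotProduct_self_eq_zero.mp (hx' x hx)
  have : a ∈ W ⊔ B.orthogonal W := by rw [hc.sup_eq_top]; trivial
  obtain ⟨w, hw, z, hz, rfl⟩ := Submodule.mem_sup.mp this
  refine ⟨w, hw, fun v hv => ?_⟩
  rw [add_sub_cancel_left]
  exact hz v hv

/-- submodule of functions independent of the coordinates in `M` -/
def DepS (n : ℕ) {S₁ S₂ : Type} (M : Finset (S₁ × S₂)) : Submodule ℚ (KSpace n S₁ S₂) where
  carrier := {A | Dep M A}
  zero_mem' := by intro ψ ψ' _ _; rfl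
  add_mem' := by
    intro A B hA hB ψ ψ' h1 h2
    simp only [Pi.add_apply]
    rw [hA ψ ψ' h1 h2, hB ψ ψ' h1 h2]
  smul_mem' := by
    intro c A hA ψ ψ' h1 h2
    simp only [Pi.smul_apply]
    rw [hA ψ ψ' h1 h2]

theorem ins_insert {n : ℕ} {S₁ S₂ : Type} [DecidableEq S₁] [DecidableEq S₂]
    (M : Finset (S₁ × S₂)) (s : S₁) (t : S₂) (V : KSpace n S₁ S₂) :
    ins M (ins {(s, t)} V) = ins (insert (s, t) M) V := by
  funext ψ
  have : Cmp (insert (s, t) M) ψ ↔ Cmp M ψ ∧ Cmp {(s, t)} ψ := by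
    simp only [Cmp, Finset.mem_insert, Finset.mem_singleton, Prod.mk.injEq]
    grind
  simp only [ins_apply]
  by_cases h1 : Cmp M ψ <;> by_cases h2 : Cmp {(s, t)} ψ <;> simp [h1, h2, this]

theorem isMt_insert {S₁ S₂ : Type} [DecidableEq S₁] [DecidableEq S₂]
    {M : Finset (S₁ × S₂)} (hM : IsMt M) {s : S₁} {t : S₂} (hs : ∀ b, (s, b) ∉ M)
    (ht : ∀ a, (a, t) ∉ M) : IsMt (insert (s, t) M) := by
  obtain ⟨h1, h2⟩ := hM
  constructor
  · rintro ⟨a, b⟩ hp ⟨c, d⟩ hq h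
    rw [Finset.mem_insert] at hp hq
    rcases hp with hp | hp <;> rcases hq with hq | hq
    · rw [hp, hq]
    · grind
    · grind
    · exact h1 _ hp _ hq h
  · rintro ⟨a, b⟩ hp ⟨c, d⟩ hq h
    rw [Finset.mem_insert] at hp hq
    rcases hp with hp | hp <;> rcases hq with hq | hq
    · rw [hp, hq]
    · grind
    · grind
    · exact h2 _ hp _ hq h

/-- One step of the decomposition. -/
theorem decomp {n : ℕ} [NeZero n] {S₁ S₂ : Type} [Fintype S₁] [Fintype S₂] [DecidableEq S₁]
    [DecidableEq S₂] (M : Finset (S₁ × S₂)) {A : KSpace n S₁ S₂} (hA : Dep M A) :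
    ∃ w ∈ Submodule.span ℚ {T : KSpace n S₁ S₂ | ∃ s t V, (∀ b, (s, b) ∉ M) ∧ (∀ a, (a, t) ∉ M) ∧
        Dep (insert (s, t) M) V ∧ T = ins {(s, t)} V}, Dep M (A - w) ∧ Trl M (A - w) := by
  classical
  set W := Submodule.span ℚ {T : KSpace n S₁ S₂ | ∃ s t V, (∀ b, (s, b) ∉ M) ∧
    (∀ a, (a, t) ∉ M) ∧ Dep (insert (s, t) M) V ∧ T = ins {(s, t)} V} with hW
  have hWD : W ≤ DepS n M := by
    rw [hW, Submodule.span_le]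
    rintro T ⟨s, t, V, hs, ht, hV, rfl⟩ ψ ψ' h1 h2
    have e : Cmp {(s, t)} ψ ↔ Cmp {(s, t)} ψ' := by
      simp [Cmp, h1 s hs, h2 t ht]
    simp only [ins_apply, e]
    congr 1
    apply hV
    · intro a ha
      exact h1 a fun b hb => ha b (Finset.mem_insert_of_mem hb)
    · intro b hb
      exact h2 b fun a ha => hb a (Finset.mem_insert_of_mem ha)
  obtain ⟨w, hw, horth⟩ := exists_orth W A
  have hD : Dep M (A - w) := (DepS n M).sub_mem hA (hWD hw)
  refine ⟨w, hw, hD, ?_⟩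
  set X := A - w with hX
  intro s t hs ht
  set V : KSpace n S₁ S₂ := fun ψ => ∑ i : Fin n, X (upd s t i ψ) with hV
  have hVD : Dep (insert (s, t) M) V := by
    intro ψ ψ' h1 h2
    simp only [hV]
    refine Finset.sum_congr rfl fun i _ => ?_
    apply hD
    · intro a ha
      by_cases has : a = s
      · simp [upd, has]
      · simp only [upd, has, if_false]
        apply h1
        intro b hb
        rcases Finset.mem_insert.mp hb with h | h
        · exact has (congrArg Prod.fst h)
        · exact ha b h
    · intro b hb
      by_cases hbt : b = t
      · simp [upd, hbt]
      · simp only [upd, hbt, if_false]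
        apply h2
        intro a ha
        rcases Finset.mem_insert.mp ha with h | h
        · exact hbt (congrArg Prod.snd h)
        · exact hb a h
  have hz : ∑ ψ, ins {(s, t)} V ψ * X ψ = 0 :=
    horth _ (Submodule.subset_span ⟨s, t, V, hs, ht, hVD, rfl⟩)
  have hVupd : ∀ i ψ, V (upd s t i ψ) = V ψ := by
    intro i ψ
    apply hVD
    · intro a ha
      have : a ≠ s := by
        rintro rfl
        exact ha t (Finset.mem_insert_self _ _)
      simp [upd, this]
    · intro b hb
      have : b ≠ t := by
        rintro rfl
        exact hb s (Finset.mem_insert_self _ _)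
      simp [upd, this]
  have hsq : ∑ ψ, ins {(s, t)} V ψ * ins {(s, t)} V ψ = 0 := by
    have h1 := shf_sum (Sum.elim (fun a : S₁ => a = s) (fun b : S₂ => b = t))
      (fun ψ => ins {(s, t)} V ψ * X ψ)
    rw [hz, mul_zero] at h1
    rw [← h1]
    refine Finset.sum_congr rfl fun ψ _ => ?_
    have hcs : ∀ a b, (a, b) ∈ ({(s, t)} : Finset (S₁ × S₂)) → (a = s ↔ b = t) := by
      simp
    simp only [ins_apply, cmp_shf hcs]
    by_cases hc : Cmp {(s, t)} ψ
    swap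
    · simp [hc]
    have hst : ψ (Sum.inl s) = ψ (Sum.inr t) := hc s t (by simp)
    have e2 : ∀ k, shf (Sum.elim (fun a : S₁ => a = s) (fun b : S₂ => b = t)) k ψ
        = upd s t (ψ (Sum.inl s) + k) ψ := by
      intro k
      funext z
      rcases z with a | b
      · by_cases has : a = s
        · subst has
          simp [shf, upd]
        · simp [shf, upd, has]
      · by_cases hbt : b = t
        · subst hbt
          simp [shf, upd, hst]
        · simp [shf, upd, hbt]
    simp only [e2, hc, if_true, hVupd]
    rw [← Finset.mul_sum]
    congr 1
    exact (Equiv.sum_comp (Equiv.addLeft (ψ (Sum.inl s))) (fun k => X (upd s t k ψ))).symm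
  have h0 : ins {(s, t)} V = 0 := dotProduct_self_eq_zero.mp hsq
  intro ψ
  have h1 := congrFun h0 (upd s t 0 ψ)
  have hc : Cmp {(s, t)} (upd s t (0 : Fin n) ψ) := by simp [Cmp, upd]
  rw [ins_apply, if_pos hc, hVupd] at h1
  exact h1

theorem isMt_card_le {S₁ S₂ : Type} [Fintype S₁] [Fintype S₂] [DecidableEq S₁]
    [DecidableEq S₂] {M : Finset (S₁ × S₂)} (hM : IsMt M) :
    M.card ≤ Nat.min (Fintype.card S₁) (Fintype.card S₂) := by
  apply le_min
  · rw [← Finset.card_image_of_injOn (fun p hp q hq h => hM.1 p hp q hq h)]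
    exact Finset.card_le_univ _
  · rw [← Finset.card_image_of_injOn (fun p hp q hq h => hM.2 p hp q hq h)]
    exact Finset.card_le_univ _

theorem ins_mem_sup {n : ℕ} [NeZero n] {S₁ S₂ : Type} [Fintype S₁] [Fintype S₂] [DecidableEq S₁]
    [DecidableEq S₂] : ∀ (d : ℕ) (M : Finset (S₁ × S₂)), IsMt M →
    Fintype.card S₁ - M.card = d → ∀ A : KSpace n S₁ S₂, Dep M A →
    ins M A ∈ ⨆ i : Fin (Nat.min (Fintype.card S₁) (Fintype.card S₂) + 1), Gp n S₁ S₂ i.val := by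
  intro d
  induction d using Nat.strong_induction_on with
  | _ d ih =>
    intro M hM hd A hA
    obtain ⟨w, hw, h1, h2⟩ := decomp M hA
    have hsplit : ins M A = ins M w + ins M (A - w) := by rw [← map_add]; congr 1; abel
    rw [hsplit]
    apply Submodule.add_mem
    · have hle : Submodule.span ℚ {T : KSpace n S₁ S₂ | ∃ s t V, (∀ b, (s, b) ∉ M) ∧
          (∀ a, (a, t) ∉ M) ∧ Dep (insert (s, t) M) V ∧ T = ins {(s, t)} V} ≤
          Submodule.comap (ins M) (⨆ i : Fin (Nat.min (Fintype.card S₁) (Fintype.card S₂) + 1),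
            Gp n S₁ S₂ i.val) := by
        rw [Submodule.span_le]
        rintro T ⟨s, t, V, hs, ht, hV, rfl⟩
        rw [SetLike.mem_coe, Submodule.mem_comap]
        rw [ins_insert]
        have hm := isMt_insert hM hs ht
        have hc : (insert (s, t) M).card = M.card + 1 := Finset.card_insert_of_notMem (hs t)
        have hb : (insert (s, t) M).card ≤ Fintype.card S₁ :=
          (isMt_card_le hm).trans (Nat.min_le_left _ _)
        exact ih _ (by omega) _ hm rfl V hV
      exact hle hw
    · refine Submodule.mem_iSup_of_mem ⟨M.card, Nat.lt_succ_of_le (isMt_card_le hM)⟩ ?_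
      exact Submodule.subset_span ⟨M, A - w, hM, rfl, h1, h2, rfl⟩

theorem Gp_sup {n : ℕ} [NeZero n] {S₁ S₂ : Type} [Fintype S₁] [Fintype S₂] [DecidableEq S₁]
    [DecidableEq S₂] :
    ⨆ i : Fin (Nat.min (Fintype.card S₁) (Fintype.card S₂) + 1), Gp n S₁ S₂ i.val = ⊤ := by
  rw [eq_top_iff]
  intro A _
  have h := ins_mem_sup (n := n) _ (∅ : Finset (S₁ × S₂)) (by simp [IsMt]) rfl A (by
    intro ψ ψ' h1 h2
    congr 1
    funext z
    rcases z with a | b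
    · exact h1 a (by simp)
    · exact h2 b (by simp))
  have e : ins ∅ A = A := by
    funext ψ
    simp [ins_apply, Cmp]
  rwa [e] at h

theorem mem_Kcirc {n : ℕ} [NeZero n] {S₁ S₂ : Type} [DecidableEq S₁]
    [DecidableEq S₂] (A : KSpace n S₁ S₂) :
    A ∈ Kcirc n S₁ S₂ ↔ ∀ s t ψ, ∑ i : Fin n, A (upd s t i ψ) = 0 := by
  simp only [Kcirc, Submodule.mem_iInf, LinearMap.mem_ker]
  refine forall_congr' fun s => forall_congr' fun t => ?_
  constructor
  · intro h ψ
    have h1 := congrFun h (Sum.elim (fun x => ψ (Sum.inl x.1)) (fun y => ψ (Sum.inr y.1)))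
    simp only [contraction, LinearMap.coe_mk, AddHom.coe_mk, Pi.zero_apply] at h1
    rw [← h1]
    refine Finset.sum_congr rfl fun i _ => ?_
    congr 1
  · intro h
    funext φ
    have h1 := h (Sum.elim (fun x => if h : x = s then 0 else φ (Sum.inl ⟨x, h⟩))
      (fun y => if h : y = t then 0 else φ (Sum.inr ⟨y, h⟩)))
    simp only [contraction, LinearMap.coe_mk, AddHom.coe_mk, Pi.zero_apply]
    rw [← h1]
    refine Finset.sum_congr rfl fun i _ => ?_
    congr 1
    funext z
    rcases z with a | b
    · by_cases h : a = s <;> simp [upd, h]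
    · by_cases h : b = t <;> simp [upd, h]

theorem Fpiece_le {n : ℕ} [NeZero n] {S₁ S₂ : Type} [DecidableEq S₁]
    [DecidableEq S₂] (i : ℕ) : Fpiece n S₁ S₂ i ≤ Gp n S₁ S₂ i := by
  unfold Fpiece
  refine iSup_le fun I₁ => iSup_le fun I₂ => iSup_le fun h1 => iSup_le fun h2 => iSup_le fun m => ?_
  rintro T ⟨U, hU, rfl⟩
  have hU' : U ∈ Kcirc n {x : S₁ // x ∉ I₁} {y : S₂ // y ∉ I₂} := hU
  rw [mem_Kcirc] at hU'
  apply Submodule.subset_span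
  set M : Finset (S₁ × S₂) := I₁.attach.image (fun a => (a.1, (m a).1)) with hMdef
  have mM : ∀ a b, (a, b) ∈ M ↔ ∃ h : a ∈ I₁, (m ⟨a, h⟩).1 = b := by
    intro a b
    simp [hMdef]
  have mM1 : ∀ a, (∀ b, (a, b) ∉ M) → a ∉ I₁ := by
    intro a h ha
    exact h _ ((mM _ _).mpr ⟨ha, rfl⟩)
  have mM2 : ∀ b, (∀ a, (a, b) ∉ M) → b ∉ I₂ := by
    intro b h hb
    refine h (m.symm ⟨b, hb⟩).1 ((mM _ _).mpr ⟨(m.symm ⟨b, hb⟩).2, ?_⟩)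
    simp
  have mM1' : ∀ a, a ∉ I₁ → (∀ b, (a, b) ∉ M) := by
    intro a ha b hb
    exact ha ((mM _ _).mp hb).1
  have mM2' : ∀ b, b ∉ I₂ → (∀ a, (a, b) ∉ M) := by
    intro b hb a hab
    obtain ⟨h, rfl⟩ := (mM _ _).mp hab
    exact hb (m _).2
  refine ⟨M, fun ψ => U (Sum.elim (fun x => ψ (Sum.inl x.1)) (fun y => ψ (Sum.inr y.1))),
    ?_, ?_, ?_, ?_, ?_⟩
  · constructor
    · rintro ⟨a, b⟩ hp ⟨c, d⟩ hq h
      obtain ⟨h, rfl⟩ := (mM _ _).mp hp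
      obtain ⟨h, rfl⟩ := (mM _ _).mp hq
      simp only at h
      subst h
      rfl
    · rintro ⟨a, b⟩ hp ⟨c, d⟩ hq h
      obtain ⟨h, rfl⟩ := (mM _ _).mp hp
      obtain ⟨h, rfl⟩ := (mM _ _).mp hq
      simp only at h
      have := m.injective (Subtype.ext h)
      grind
  · rw [hMdef, Finset.card_image_of_injective, Finset.card_attach, h1]
    intro a b hab
    exact Subtype.ext (congrArg Prod.fst hab)
  · intro ψ ψ' e1 e2
    simp only
    congr 1
    funext z
    rcases z with a | b
    · exact e1 _ (mM1' _ a.2)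
    · exact e2 _ (mM2' _ b.2)
  · intro s t hs ht ψ
    rw [← hU' ⟨s, mM1 s hs⟩ ⟨t, mM2 t ht⟩
      (Sum.elim (fun x => ψ (Sum.inl x.1)) (fun y => ψ (Sum.inr y.1)))]
    refine Finset.sum_congr rfl fun i _ => ?_
    beta_reduce
    congr 1
    funext z
    rcases z with ⟨a, ha⟩ | ⟨b, hb⟩
    · simp [upd]
    · simp [upd]
  · funext ψ
    have e : Cmp M ψ ↔ ∀ a : ↥I₁, ψ (Sum.inl a.1) = ψ (Sum.inr (m a).1) := by
      constructor
      · intro h a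
        exact h _ _ ((mM _ _).mpr ⟨a.2, rfl⟩)
      · intro h a b hab
        obtain ⟨h', rfl⟩ := (mM _ _).mp hab
        exact h ⟨a, h'⟩
    simp only [ins_apply, insertMany, LinearMap.coe_mk, AddHom.coe_mk, e]
    split_ifs
    · congr 1
      funext z
      rcases z with a | b <;> rfl
    · rfl

theorem le_Fpiece {n : ℕ} [NeZero n] {S₁ S₂ : Type} [DecidableEq S₁]
    [DecidableEq S₂] (i : ℕ) : Gp n S₁ S₂ i ≤ Fpiece n S₁ S₂ i := by
  unfold Gp
  rw [Submodule.span_le]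
  rintro T ⟨M, A, hM, hc, hD, hT, rfl⟩
  have hi1 : Set.InjOn Prod.fst (M : Set (S₁ × S₂)) := fun p hp q hq h => hM.1 p hp q hq h
  have hi2 : Set.InjOn Prod.snd (M : Set (S₁ × S₂)) := fun p hp q hq h => hM.2 p hp q hq h
  let f1 : ↥M → ↥(M.image Prod.fst) := fun p => ⟨p.1.1, Finset.mem_image_of_mem _ p.2⟩
  let f2 : ↥M → ↥(M.image Prod.snd) := fun p => ⟨p.1.2, Finset.mem_image_of_mem _ p.2⟩
  have b1 : Function.Bijective f1 := by
    constructor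
    · intro p q h
      exact Subtype.ext (hM.1 _ p.2 _ q.2 (congrArg Subtype.val h))
    · rintro ⟨a, ha⟩
      obtain ⟨p, hp, rfl⟩ := Finset.mem_image.mp ha
      exact ⟨⟨p, hp⟩, rfl⟩
  have b2 : Function.Bijective f2 := by
    constructor
    · intro p q h
      exact Subtype.ext (hM.2 _ p.2 _ q.2 (congrArg Subtype.val h))
    · rintro ⟨a, ha⟩
      obtain ⟨p, hp, rfl⟩ := Finset.mem_image.mp ha
      exact ⟨⟨p, hp⟩, rfl⟩
  let E1 := Equiv.ofBijective f1 b1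
  let E2 := Equiv.ofBijective f2 b2
  have n1 : ∀ a, a ∉ M.image Prod.fst ↔ ∀ b, (a, b) ∉ M := by
    intro a
    simp
  have n2 : ∀ b, b ∉ M.image Prod.snd ↔ ∀ a, (a, b) ∉ M := by
    intro a
    simp
  unfold Fpiece
  refine Submodule.mem_iSup_of_mem (M.image Prod.fst) <|
    Submodule.mem_iSup_of_mem (M.image Prod.snd) <|
    Submodule.mem_iSup_of_mem (by rw [Finset.card_image_of_injOn hi1, hc]) <|
    Submodule.mem_iSup_of_mem (by rw [Finset.card_image_of_injOn hi2, hc]) <|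
    Submodule.mem_iSup_of_mem (E1.symm.trans E2) ?_
  refine ⟨fun φ => A (Sum.elim
    (fun x => if h : x ∉ M.image Prod.fst then φ (Sum.inl ⟨x, h⟩) else 0)
    (fun y => if h : y ∉ M.image Prod.snd then φ (Sum.inr ⟨y, h⟩) else 0)), ?_, ?_⟩
  · change _ ∈ Kcirc n _ _
    rw [mem_Kcirc]
    rintro ⟨s, hs⟩ ⟨t, ht⟩ φ
    rw [← hT s t ((n1 s).mp hs) ((n2 t).mp ht) (Sum.elim
      (fun x => if h : x ∉ M.image Prod.fst then φ (Sum.inl ⟨x, h⟩) else 0)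
      (fun y => if h : y ∉ M.image Prod.snd then φ (Sum.inr ⟨y, h⟩) else 0))]
    refine Finset.sum_congr rfl fun i _ => ?_
    congr 1
    funext z
    rcases z with a | b
    · by_cases h : a = s
      · subst h
        simp only [Sum.elim_inl, upd, dif_pos hs, if_true]
      · simp [upd, h]
    · by_cases h : b = t
      · subst h
        simp only [Sum.elim_inr, upd, dif_pos ht, if_true]
      · simp [upd, h]
  · funext ψ
    have e : Cmp M ψ ↔ ∀ a : ↥(M.image Prod.fst),
        ψ (Sum.inl a.1) = ψ (Sum.inr ((E1.symm.trans E2) a).1) := by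
      constructor
      · intro h a
        obtain ⟨p, rfl⟩ := E1.surjective a
        simp only [Equiv.trans_apply, Equiv.symm_apply_apply]
        exact h _ _ p.2
      · intro h a b hab
        have := h (E1 ⟨(a, b), hab⟩)
        simp only [Equiv.trans_apply, Equiv.symm_apply_apply] at this
        exact this
    simp only [ins_apply, insertMany, LinearMap.coe_mk, AddHom.coe_mk, e]
    split_ifs
    · apply hD
      · intro a ha
        simp only [Sum.elim_inl, dif_pos ((n1 a).mpr ha)]
      · intro b hb
        simp only [Sum.elim_inr, dif_pos ((n2 b).mpr hb)]
    · rfl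

theorem Gp_zero {n : ℕ} [NeZero n] {S₁ S₂ : Type} [DecidableEq S₁]
    [DecidableEq S₂] : Gp n S₁ S₂ 0 = Kcirc n S₁ S₂ := by
  have e : ∀ A : KSpace n S₁ S₂, ins ∅ A = A := by
    intro A
    funext ψ
    simp [ins_apply, Cmp]
  apply le_antisymm
  · unfold Gp
    rw [Submodule.span_le]
    rintro T ⟨M, A, hM, hc, hD, hT, rfl⟩
    obtain rfl := Finset.card_eq_zero.mp hc
    rw [e]
    change A ∈ Kcirc n S₁ S₂
    rw [mem_Kcirc]
    intro s t
    exact hT s t (by simp) (by simp)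
  · intro A hA
    rw [mem_Kcirc] at hA
    refine Submodule.subset_span ⟨∅, A, by simp [IsMt], rfl, ?_, ?_, (e A).symm⟩
    · intro ψ ψ' h1 h2
      congr 1
      funext z
      rcases z with a | b
      · exact h1 a (by simp)
      · exact h2 b (by simp)
    · intro s t _ _
      exact hA s t

theorem statement_1 (n : ℕ) (hn : 0 < n) (S₁ S₂ : Type)
    [Fintype S₁] [Fintype S₂] [DecidableEq S₁] [DecidableEq S₂] :
    DirectSum.IsInternal
      (fun i : Fin (Nat.min (Fintype.card S₁) (Fintype.card S₂) + 1) =>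
        Fpiece n S₁ S₂ i.val) ∧
    Fpiece n S₁ S₂ 0 = Kcirc n S₁ S₂ := by
  have : NeZero n := ⟨hn.ne'⟩
  have hFG : ∀ i, Fpiece n S₁ S₂ i = Gp n S₁ S₂ i := fun i =>
    le_antisymm (Fpiece_le i) (le_Fpiece i)
  simp only [hFG]
  exact ⟨DirectSum.isInternal_submodule_of_iSupIndep_of_iSup_eq_top (Gp_indep _) Gp_sup, Gp_zero⟩
end

section
/- Let n be a positive integer and S = (S₁,S₂) a pair of finite sets with n ≥ |S₁| + |S₂|. Then the family of subspaces ω_m(K°_{S∖I}(n)) ⊆ K_S(n), indexed by all pairs (I,m) where I ⊆ S with |I₁| = |I₂| and m is a bipartite matching of I, forms an internal direct sum decomposition: K_S(n) = ⊕_{I⊆S} ⊕_{m ∈ M(I)} ω_m(K°_{S∖I}(n)). -/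
/-!
Statement 2: For `n ≥ |S₁| + |S₂|`, the family of subspaces `ω_m(K°_{S∖I}(n)) ⊆ K_S(n)`,
indexed by all pairs `(I, m)` with `I ⊆ S`, `|I₁| = |I₂|` and `m` a bipartite matching of
`I`, forms an internal direct sum decomposition of `K_S(n)`.
-/

open scoped BigOperators

/-- The operator by which the elementary matrix indexed by `(a, b)` acts on `K_S(n)`. -/
def Eop (n : ℕ) {S₁ S₂ : Type} [Fintype S₁] [Fintype S₂] [DecidableEq S₁] [DecidableEq S₂]
    (a b : Fin n) : KSpace n S₁ S₂ →ₗ[ℚ] KSpace n S₁ S₂ where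
  toFun v := fun φ =>
    (∑ s : S₁, if φ (Sum.inl s) = a then v (Function.update φ (Sum.inl s) b) else 0)
      - ∑ t : S₂, if φ (Sum.inr t) = b then v (Function.update φ (Sum.inr t) a) else 0
  map_add' v w := by
    funext φ
    simp only [Pi.add_apply, ← Finset.sum_filter, Finset.sum_add_distrib]
    ring
  map_smul' c v := by
    funext φ
    simp only [Pi.smul_apply, ← Finset.sum_filter, smul_eq_mul, RingHom.id_apply,
      ← Finset.mul_sum, mul_sub]

theorem Eop_apply (n : ℕ) {S₁ S₂ : Type} [Fintype S₁] [Fintype S₂] [DecidableEq S₁]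
    [DecidableEq S₂] (a b : Fin n) (v : KSpace n S₁ S₂) (φ : S₁ ⊕ S₂ → Fin n) :
    Eop n a b v φ =
    (∑ s : S₁, if φ (Sum.inl s) = a then v (Function.update φ (Sum.inl s) b) else 0)
      - ∑ t : S₂, if φ (Sum.inr t) = b then v (Function.update φ (Sum.inr t) a) else 0 := rfl

theorem mem_Kcirc_iff (n : ℕ) {S₁ S₂ : Type} [DecidableEq S₁] [DecidableEq S₂]
    (v : KSpace n S₁ S₂) :
    v ∈ Kcirc n S₁ S₂ ↔ ∀ (s : S₁) (t : S₂) (φ : S₁ ⊕ S₂ → Fin n),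
      ∑ i : Fin n, v (Function.update (Function.update φ (Sum.inl s) i) (Sum.inr t) i) = 0 := by
  simp only [Kcirc, Submodule.mem_iInf, LinearMap.mem_ker]
  refine forall_congr' fun s => forall_congr' fun t => ?_
  constructor
  · intro h φ
    have h' := congrFun h (Sum.elim (fun x => φ (Sum.inl x.1)) (fun y => φ (Sum.inr y.1)))
    simp only [contraction, LinearMap.coe_mk, AddHom.coe_mk, Pi.zero_apply] at h'
    rw [← h']
    refine Finset.sum_congr rfl fun i _ => congrArg v ?_
    funext z
    rcases z with x | y
    · by_cases hx : x = s
      · subst hx; simp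
      · simp [hx]
    · by_cases hx : y = t
      · subst hx; simp
      · simp [hx]
  · intro h
    funext φ
    by_cases hn : n = 0
    · subst hn
      simp [contraction]
    obtain ⟨i0⟩ : Nonempty (Fin n) := ⟨⟨0, Nat.pos_of_ne_zero hn⟩⟩
    refine Eq.trans ?_ (h (Sum.elim (fun x => if h : x = s then i0 else φ (Sum.inl ⟨x, h⟩))
      (fun y => if h : y = t then i0 else φ (Sum.inr ⟨y, h⟩))))
    simp only [contraction, LinearMap.coe_mk, AddHom.coe_mk]
    refine Finset.sum_congr rfl fun i _ => congrArg v ?_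
    funext z
    rcases z with x | y
    · by_cases hx : x = s
      · simp only [Function.update_apply, reduceCtorEq, if_false, hx, if_true, dif_pos]
      · simp only [Function.update_apply, reduceCtorEq, if_false, Sum.inl.injEq, hx,
          Sum.elim_inl, dif_neg, not_false_eq_true]
    · by_cases hx : y = t
      · simp only [Function.update_apply, hx, if_true, dif_pos]
      · simp only [Function.update_apply, reduceCtorEq, if_false, Sum.inr.injEq, hx,
          Sum.elim_inr, dif_neg, not_false_eq_true]

theorem Eop_mem_Kcirc (n : ℕ) {S₁ S₂ : Type} [Fintype S₁] [Fintype S₂] [DecidableEq S₁]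
    [DecidableEq S₂] (a b : Fin n) (v : KSpace n S₁ S₂) (hv : v ∈ Kcirc n S₁ S₂) :
    Eop n a b v ∈ Kcirc n S₁ S₂ := by
  rw [mem_Kcirc_iff] at hv ⊢
  intro s t φ
  simp only [Eop_apply, Finset.sum_sub_distrib]
  rw [Finset.sum_comm, Finset.sum_comm (s := (Finset.univ : Finset (Fin n)))
    (t := (Finset.univ : Finset S₂))]
  rw [← Finset.add_sum_erase _ _ (Finset.mem_univ s), ← Finset.add_sum_erase _ _ (Finset.mem_univ t)]
  have h1 : ∑ x ∈ Finset.univ.erase s, ∑ i : Fin n,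
      (if Function.update (Function.update φ (Sum.inl s) i) (Sum.inr t) i (Sum.inl x) = a then
        v (Function.update (Function.update (Function.update φ (Sum.inl s) i) (Sum.inr t) i)
          (Sum.inl x) b) else 0) = 0 := by
    refine Finset.sum_eq_zero fun x hx => ?_
    have hx : x ≠ s := Finset.ne_of_mem_erase hx
    by_cases hxa : φ (Sum.inl x) = a
    · rw [← hv s t (Function.update φ (Sum.inl x) b)]
      refine Finset.sum_congr rfl fun i _ => ?_
      simp only [Function.update_apply, reduceCtorEq, if_false, Sum.inl.injEq, hx, hxa, if_true]
      congr 1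
      funext z
      simp only [Function.update_apply]
      grind
    · refine Finset.sum_eq_zero fun i _ => ?_
      simp [hx, hxa]
  have h2 : ∑ x ∈ Finset.univ.erase t, ∑ i : Fin n,
      (if Function.update (Function.update φ (Sum.inl s) i) (Sum.inr t) i (Sum.inr x) = b then
        v (Function.update (Function.update (Function.update φ (Sum.inl s) i) (Sum.inr t) i)
          (Sum.inr x) a) else 0) = 0 := by
    refine Finset.sum_eq_zero fun x hx => ?_
    have hx : x ≠ t := Finset.ne_of_mem_erase hx
    by_cases hxa : φ (Sum.inr x) = b
    · rw [← hv s t (Function.update φ (Sum.inr x) a)]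
      refine Finset.sum_congr rfl fun i _ => ?_
      simp only [Function.update_apply, reduceCtorEq, if_false, Sum.inr.injEq, hx, hxa, if_true]
      congr 1
      funext z
      simp only [Function.update_apply]
      grind
    · refine Finset.sum_eq_zero fun i _ => ?_
      simp [hx, hxa]
  rw [h1, h2]
  simp only [Function.update_apply, reduceCtorEq, if_false, if_true, Finset.sum_ite_eq',
    Finset.mem_univ, add_zero]
  rw [sub_eq_zero]
  congr 1
  funext z
  simp only [Function.update_apply]
  grind

/-- Vanishing criterion: a family of traceless tensors that is stable under the elementary
operators and vanishes at all coordinates with disjoint images is zero. -/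
theorem key_vanish (n : ℕ) {S₁ S₂ : Type} [Fintype S₁] [Fintype S₂] [DecidableEq S₁]
    [DecidableEq S₂] (hcard : Fintype.card S₁ + Fintype.card S₂ ≤ n)
    (W : Set (KSpace n S₁ S₂)) (hK : ∀ v ∈ W, v ∈ Kcirc n S₁ S₂)
    (hE : ∀ v ∈ W, ∀ a b, Eop n a b v ∈ W)
    (hD : ∀ v ∈ W, ∀ φ : S₁ ⊕ S₂ → Fin n,
      (∀ s t, φ (Sum.inl s) ≠ φ (Sum.inr t)) → v φ = 0) :
    ∀ v ∈ W, v = 0 := by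
  have main : ∀ A : Finset S₁, ∀ v ∈ W, ∀ φ : S₁ ⊕ S₂ → Fin n,
      (∀ s, s ∉ A → ∀ t, φ (Sum.inl s) ≠ φ (Sum.inr t)) → v φ = 0 := by
    intro A
    induction A using Finset.induction_on with
    | empty => intro v hv φ h; exact hD v hv φ fun s t => h s (by simp) t
    | insert s0 A hs0 ih =>
      intro v hv
      have near : ∀ (φ : S₁ ⊕ S₂ → Fin n) (s : S₁) (t : S₂), s ∉ A →
          φ (Sum.inl s) = φ (Sum.inr t) →
          (∀ s', s' ∉ A → ∀ t', φ (Sum.inl s') = φ (Sum.inr t') → s' = s ∧ t' = t) →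
          v φ = 0 := by
        classical
        let N : Finset (S₁ ⊕ S₂ → Fin n) := Finset.univ.filter fun φ => ∃ s t, s ∉ A ∧
          φ (Sum.inl s) = φ (Sum.inr t) ∧
          (∀ s', s' ∉ A → ∀ t', φ (Sum.inl s') = φ (Sum.inr t') → s' = s ∧ t' = t)
        have hN : ∀ φ, φ ∈ N ↔ ∃ s t, s ∉ A ∧
          φ (Sum.inl s) = φ (Sum.inr t) ∧
          (∀ s', s' ∉ A → ∀ t', φ (Sum.inl s') = φ (Sum.inr t') → s' = s ∧ t' = t) := by
          intro φ; simp [N]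
        rcases N.eq_empty_or_nonempty with hemp | hne
        · intro φ s t h1 h2 h3
          have : φ ∈ N := (hN φ).2 ⟨s, t, h1, h2, h3⟩
          simp [hemp] at this
        obtain ⟨φ, hφN, hmax⟩ := N.exists_max_image (fun φ => |v φ|) hne
        suffices hz : v φ = 0 by
          intro χ s t h1 h2 h3
          have := hmax χ ((hN χ).2 ⟨s, t, h1, h2, h3⟩)
          rw [hz, abs_zero] at this
          exact abs_nonpos_iff.1 this
        obtain ⟨s, t, hs, hst, huniq⟩ := (hN φ).1 hφN
        have htr := (mem_Kcirc_iff n v).1 (hK v hv) s t φ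
        set b := φ (Sum.inl s) with hb
        set M := |v φ| with hM
        have hM0 : 0 ≤ M := abs_nonneg _
        have bound : ∀ i : Fin n,
            |v (Function.update (Function.update φ (Sum.inl s) i) (Sum.inr t) i) - v φ| ≤
              (∑ s' ∈ Finset.univ.erase s, if φ (Sum.inl s') = i then M else 0) +
              (∑ t' ∈ Finset.univ.erase t, if φ (Sum.inr t') = i then M else 0) := by
          intro i
          have p1 : 0 ≤ ∑ s' ∈ Finset.univ.erase s, if φ (Sum.inl s') = i then M else 0 :=
            Finset.sum_nonneg fun _ _ => by split_ifs <;> simp [hM0]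
          have p2 : 0 ≤ ∑ t' ∈ Finset.univ.erase t, if φ (Sum.inr t') = i then M else 0 :=
            Finset.sum_nonneg fun _ _ => by split_ifs <;> simp [hM0]
          by_cases hib : i = b
          · have : Function.update (Function.update φ (Sum.inl s) i) (Sum.inr t) i = φ := by
              funext z
              simp only [Function.update_apply]
              grind
            rw [this, sub_self, abs_zero]
            positivity
          by_cases hi : ∃ s', s' ∉ A ∧ s' ≠ s ∧ φ (Sum.inl s') = i
          · skip
            obtain ⟨s1, hs1A, hs1s, hs1⟩ := hi
            have hnt : ∀ t', φ (Sum.inr t') ≠ i := fun t' h =>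
              hs1s (huniq s1 hs1A t' (hs1.trans h.symm)).1
            have e := ih _ (hE v hv i b) (Function.update φ (Sum.inl s) i) (by
              intro s' hs' t'
              simp only [Function.update_apply]
              grind)
            rw [Eop_apply, ← Finset.add_sum_erase _ _ (Finset.mem_univ s),
              ← Finset.add_sum_erase _ _ (Finset.mem_univ t)] at e
            have z2 : ∑ t' ∈ Finset.univ.erase t,
                (if Function.update φ (Sum.inl s) i (Sum.inr t') = b then
                v (Function.update (Function.update φ (Sum.inl s) i) (Sum.inr t') i) else 0)
                = 0 := by
              refine Finset.sum_eq_zero fun t' ht' => ?_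
              rw [if_neg]
              simp only [Function.update_apply]
              grind
            have q1 : Function.update (Function.update φ (Sum.inl s) i) (Sum.inl s) b = φ := by
              simp [hb]
            rw [z2, q1] at e
            simp only [Function.update_self, if_true, Function.update_apply, reduceCtorEq,
              if_false, ← hst, add_zero] at e
            have e' : v (Function.update (Function.update φ (Sum.inl s) i) (Sum.inr t) i) - v φ =
              ∑ s' ∈ Finset.univ.erase s, (if (if s' = s then i else φ (Sum.inl s')) = i then
                v (Function.update (Function.update φ (Sum.inl s) i) (Sum.inl s') b) else 0) := by
              simp only [Sum.inl.injEq] at e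
              linarith
            rw [e']
            refine le_trans (Finset.abs_sum_le_sum_abs _ _) (le_trans ?_
              (le_add_of_nonneg_right p2))
            refine Finset.sum_le_sum fun s' hs' => ?_
            have hs's : s' ≠ s := Finset.ne_of_mem_erase hs'
            rw [if_neg hs's]
            split_ifs with h
            · by_cases hA : s' ∈ A
              · rw [ih v hv, abs_zero]
                · exact hM0
                · intro s'' hs'' t'
                  simp only [Function.update_apply]
                  grind
              · refine hmax _ ((hN _).2 ⟨s', t, hA, ?_, ?_⟩)
                · simp only [Function.update_apply]
                  grind
                · intro s'' hs'' t'
                  simp only [Function.update_apply]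
                  grind
            · simp
          · skip
            push Not at hi
            have e := ih _ (hE v hv b i) (Function.update φ (Sum.inr t) i) (by
              intro s' hs' t'
              simp only [Function.update_apply]
              grind)
            rw [Eop_apply, ← Finset.add_sum_erase _ _ (Finset.mem_univ s),
              ← Finset.add_sum_erase _ _ (Finset.mem_univ t)] at e
            have z2 : ∑ s' ∈ Finset.univ.erase s,
                (if Function.update φ (Sum.inr t) i (Sum.inl s') = b then
                v (Function.update (Function.update φ (Sum.inr t) i) (Sum.inl s') i) else 0)
                = 0 := by
              refine Finset.sum_eq_zero fun s' hs' => ?_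
              have hs's : s' ≠ s := Finset.ne_of_mem_erase hs'
              split_ifs with h
              · simp only [Function.update_apply, reduceCtorEq, if_false] at h
                have hA : s' ∈ A := by
                  by_contra hA
                  exact hs's (huniq s' hA t (h.trans hst)).1
                refine ih v hv _ ?_
                intro s'' hs'' t'
                simp only [Function.update_apply]
                grind
              · rfl
            have q1 : Function.update (Function.update φ (Sum.inr t) i) (Sum.inr t) b = φ := by
              simp [hst]
            have q2 : Function.update (Function.update φ (Sum.inr t) i) (Sum.inl s) i =
                Function.update (Function.update φ (Sum.inl s) i) (Sum.inr t) i :=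
              Function.update_comm (by simp) _ _ _
            rw [z2, q1, q2] at e
            simp only [Function.update_self, if_true, Function.update_apply, reduceCtorEq,
              if_false, ← hb, add_zero] at e
            have e' : v (Function.update (Function.update φ (Sum.inl s) i) (Sum.inr t) i) - v φ =
              ∑ t' ∈ Finset.univ.erase t, (if (if t' = t then i else φ (Sum.inr t')) = i then
                v (Function.update (Function.update φ (Sum.inr t) i) (Sum.inr t') b) else 0) := by
              simp only [Sum.inr.injEq] at e
              linarith
            rw [e']
            refine le_trans (Finset.abs_sum_le_sum_abs _ _) (le_trans ?_
              (le_add_of_nonneg_left p1))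
            refine Finset.sum_le_sum fun t' ht' => ?_
            have ht't : t' ≠ t := Finset.ne_of_mem_erase ht'
            rw [if_neg ht't]
            split_ifs with h
            · refine hmax _ ((hN _).2 ⟨s, t', hs, ?_, ?_⟩)
              · simp only [Function.update_apply]
                grind
              · intro s'' hs'' t''
                simp only [Function.update_apply]
                grind
            · simp
        have tot : |∑ i : Fin n,
            (v (Function.update (Function.update φ (Sum.inl s) i) (Sum.inr t) i) - v φ)| ≤
            ((Fintype.card S₁ : ℚ) - 1) * M + ((Fintype.card S₂ : ℚ) - 1) * M := by
          refine le_trans (Finset.abs_sum_le_sum_abs _ _)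
            (le_trans (Finset.sum_le_sum fun i _ => bound i) (le_of_eq ?_))
          rw [Finset.sum_add_distrib, Finset.sum_comm, Finset.sum_comm (γ := Fin n)]
          have c1 : 1 ≤ Fintype.card S₁ := Fintype.card_pos_iff.2 ⟨s⟩
          have c2 : 1 ≤ Fintype.card S₂ := Fintype.card_pos_iff.2 ⟨t⟩
          simp [Finset.card_erase_of_mem, Finset.card_univ, Nat.cast_sub c1, Nat.cast_sub c2]
        rw [Finset.sum_sub_distrib, htr] at tot
        simp only [Finset.sum_const, Finset.card_univ, Fintype.card_fin, nsmul_eq_mul, zero_sub,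
          abs_neg, abs_mul, Nat.abs_cast, ← hM] at tot
        have hc : ((Fintype.card S₁ : ℚ) + Fintype.card S₂) ≤ n := by exact_mod_cast hcard
        have : M ≤ 0 := by nlinarith [mul_le_mul_of_nonneg_right hc hM0]
        exact abs_nonpos_iff.1 this
      intro φ hφ
      by_cases hg : ∀ t, φ (Sum.inl s0) ≠ φ (Sum.inr t)
      · refine ih v hv φ fun s hs t => ?_
        by_cases h : s = s0
        · subst h; exact hg t
        · exact hφ s (by simp [h, hs]) t
      push Not at hg
      obtain ⟨t0, ht0⟩ := hg
      obtain ⟨b, hb⟩ : ∃ b, ∀ z, φ z ≠ b := by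
        by_contra hcon
        push Not at hcon
        have hsurj : Function.Surjective φ := hcon
        have hle := Fintype.card_le_of_surjective φ hsurj
        have hbij : Function.Bijective φ := by
          refine (Fintype.bijective_iff_surjective_and_card φ).2 ⟨hsurj, ?_⟩
          simp only [Fintype.card_sum, Fintype.card_fin] at hle ⊢
          omega
        have := hbij.1 ht0
        simp at this
      set i := φ (Sum.inl s0) with hi
      have e := ih _ (hE v hv b i) (Function.update φ (Sum.inl s0) b) (by
        intro s' hs' t'
        simp only [Function.update_apply]
        grind)
      rw [Eop_apply, ← Finset.add_sum_erase _ _ (Finset.mem_univ s0)] at e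
      rw [Finset.sum_eq_zero (s := Finset.univ.erase s0), Finset.sum_eq_zero (ι := S₂)] at e
      · simpa [hi] using e
      · intro t' _
        split_ifs with h
        · simp only [Function.update_apply, reduceCtorEq, if_false] at h
          refine near _ s0 t' hs0 ?_ ?_
          · simp only [Function.update_apply]
            grind
          · intro s'' hs'' t''
            simp only [Function.update_apply]
            grind
        · rfl
      · intro s' hs'
        have hs's : s' ≠ s0 := Finset.ne_of_mem_erase hs'
        rw [if_neg]
        simp [hs's, hb]
  intro v hv
  funext φ
  exact main Finset.univ v hv φ (by simp)

/-- Restriction of a coordinate function to the complement of `I`. -/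
def resF {n : ℕ} {S₁ S₂ : Type} (I₁ : Finset S₁) (I₂ : Finset S₂) (ψ : S₁ ⊕ S₂ → Fin n) :
    {x : S₁ // x ∉ I₁} ⊕ {y : S₂ // y ∉ I₂} → Fin n :=
  Sum.elim (fun x => ψ (Sum.inl x.1)) (fun y => ψ (Sum.inr y.1))

theorem insertMany_apply (n : ℕ) {S₁ S₂ : Type} [DecidableEq S₁] [DecidableEq S₂]
    (I₁ : Finset S₁) (I₂ : Finset S₂) (m : ↥I₁ ≃ ↥I₂)
    (U : KSpace n {x : S₁ // x ∉ I₁} {y : S₂ // y ∉ I₂}) (ψ : S₁ ⊕ S₂ → Fin n) :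
    insertMany n I₁ I₂ m U ψ =
      if ∀ a : ↥I₁, ψ (Sum.inl a.1) = ψ (Sum.inr (m a).1) then U (resF I₁ I₂ ψ) else 0 := by
  simp only [insertMany, LinearMap.coe_mk, AddHom.coe_mk]
  congr 2
  funext z
  rcases z with x | y <;> rfl

theorem Eop_insertMany (n : ℕ) {S₁ S₂ : Type} [Fintype S₁] [Fintype S₂] [DecidableEq S₁]
    [DecidableEq S₂] (I₁ : Finset S₁) (I₂ : Finset S₂) (m : ↥I₁ ≃ ↥I₂)
    (U : KSpace n {x : S₁ // x ∉ I₁} {y : S₂ // y ∉ I₂}) (a b : Fin n) :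
    Eop n a b (insertMany n I₁ I₂ m U) = insertMany n I₁ I₂ m (Eop n a b U) := by
  funext ψ
  rw [Eop_apply, insertMany_apply]
  have sp1 : ∀ F : S₁ → ℚ, ∑ s, F s = (∑ s : {s // s ∈ I₁}, F s) + ∑ s : {s // ¬ s ∈ I₁}, F s := by
    intro F
    rw [← Fintype.sum_subtype_add_sum_subtype (fun s => s ∈ I₁)]
    congr
    exact Subsingleton.elim _ _
  have sp2 : ∀ F : S₂ → ℚ, ∑ s, F s = (∑ s : {s // s ∈ I₂}, F s) + ∑ s : {s // ¬ s ∈ I₂}, F s := by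
    intro F
    rw [← Fintype.sum_subtype_add_sum_subtype (fun s => s ∈ I₂)]
    congr
    exact Subsingleton.elim _ _
  rw [sp1, sp2]
  have hin : (∑ s : {s // s ∈ I₁}, if ψ (Sum.inl s.1) = a then
        insertMany n I₁ I₂ m U (Function.update ψ (Sum.inl s.1) b) else 0) =
      ∑ t : {t // t ∈ I₂}, if ψ (Sum.inr t.1) = b then
        insertMany n I₁ I₂ m U (Function.update ψ (Sum.inr t.1) a) else 0 := by
    rw [← Equiv.sum_comp m]
    refine Finset.sum_congr rfl fun s _ => ?_
    have r1 : resF I₁ I₂ (Function.update ψ (Sum.inl s.1) b) = resF I₁ I₂ ψ := by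
      funext z
      rcases z with ⟨x, hx⟩ | y
      · have : x ≠ s.1 := fun h => hx (h ▸ s.2)
        simp [resF, this]
      · simp [resF]
    have r2 : resF I₁ I₂ (Function.update ψ (Sum.inr (m s).1) a) = resF I₁ I₂ ψ := by
      funext z
      rcases z with x | ⟨x, hx⟩
      · simp [resF]
      · have : x ≠ (m s).1 := fun h => hx (h ▸ (m s).2)
        simp [resF, this]
    rw [insertMany_apply, insertMany_apply, r1, r2, ← ite_and, ← ite_and]
    refine if_congr ?_ rfl rfl
    have hm : ∀ x : I₁, (m x).1 = (m s).1 ↔ x = s := fun x => by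
      rw [Subtype.coe_inj, m.apply_eq_iff_eq]
    have hm' : ∀ x : I₁, x.1 = s.1 ↔ x = s := fun x => Subtype.coe_inj
    simp only [Function.update_apply, reduceCtorEq, if_false, Sum.inl.injEq, Sum.inr.injEq, hm, hm']
    constructor
    · rintro ⟨h1, h2⟩
      have h3 := h2 s
      simp only [if_true] at h3
      refine ⟨h3.symm, fun x => ?_⟩
      have := h2 x
      grind
    · rintro ⟨h1, h2⟩
      have h3 := h2 s
      simp only [if_true] at h3
      refine ⟨h3, fun x => ?_⟩
      have := h2 x
      grind
  have ho1 : ∀ s : {s // ¬ s ∈ I₁}, (if ψ (Sum.inl s.1) = a then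
        insertMany n I₁ I₂ m U (Function.update ψ (Sum.inl s.1) b) else 0) =
      if ∀ a : ↥I₁, ψ (Sum.inl a.1) = ψ (Sum.inr (m a).1) then
        (if resF I₁ I₂ ψ (Sum.inl s) = a then U (Function.update (resF I₁ I₂ ψ) (Sum.inl s) b)
          else 0) else 0 := by
    intro s
    have r1 : resF I₁ I₂ (Function.update ψ (Sum.inl s.1) b) =
        Function.update (resF I₁ I₂ ψ) (Sum.inl s) b := by
      funext z
      rcases z with x | y
      · simp [resF, Function.update_apply, Subtype.ext_iff]
      · simp [resF, Function.update_apply]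
    rw [insertMany_apply, r1, ← ite_and, ← ite_and]
    refine if_congr (and_comm.trans (and_congr (forall_congr' fun x => ?_) Iff.rfl)) rfl rfl
    have : x.1 ≠ s.1 := fun h => s.2 (h ▸ x.2)
    simp [this]
  have ho2 : ∀ s : {s // ¬ s ∈ I₂}, (if ψ (Sum.inr s.1) = b then
        insertMany n I₁ I₂ m U (Function.update ψ (Sum.inr s.1) a) else 0) =
      if ∀ a : ↥I₁, ψ (Sum.inl a.1) = ψ (Sum.inr (m a).1) then
        (if resF I₁ I₂ ψ (Sum.inr s) = b then U (Function.update (resF I₁ I₂ ψ) (Sum.inr s) a)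
          else 0) else 0 := by
    intro s
    have r1 : resF I₁ I₂ (Function.update ψ (Sum.inr s.1) a) =
        Function.update (resF I₁ I₂ ψ) (Sum.inr s) a := by
      funext z
      rcases z with x | y
      · simp [resF, Function.update_apply]
      · simp [resF, Function.update_apply, Subtype.ext_iff]
    rw [insertMany_apply, r1, ← ite_and, ← ite_and]
    refine if_congr (and_comm.trans (and_congr (forall_congr' fun x => ?_) Iff.rfl)) rfl rfl
    have : (m x).1 ≠ s.1 := fun h => s.2 (h ▸ (m x).2)
    simp [this]
  rw [hin, Finset.sum_congr rfl fun s _ => ho1 s, Finset.sum_congr rfl fun s _ => ho2 s,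
    add_sub_add_left_eq_sub]
  split_ifs with h
  · rw [Eop_apply]
  · simp

/-- The index type of the decomposition: pairs `(I, m)` with `m` a matching of `I`. -/
abbrev MatchIdx (S₁ S₂ : Type) : Type :=
  Σ (I₁ : Finset S₁) (I₂ : Finset S₂), (↥I₁ ≃ ↥I₂)

theorem rel_zero (n : ℕ) (S₁ S₂ : Type)
    [Fintype S₁] [Fintype S₂] [DecidableEq S₁] [DecidableEq S₂]
    (hcard : Fintype.card S₁ + Fintype.card S₂ ≤ n) (k : ℕ) :
    ∀ (Im : MatchIdx S₁ S₂), Im.1.card = k →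
    ∀ v : (Im : MatchIdx S₁ S₂) →
      KSpace n {x : S₁ // x ∉ Im.1} {y : S₂ // y ∉ Im.2.1},
    (∀ Im : MatchIdx S₁ S₂, v Im ∈ Kcirc n {x : S₁ // x ∉ Im.1} {y : S₂ // y ∉ Im.2.1}) →
    ∑ Im : MatchIdx S₁ S₂, insertMany n Im.1 Im.2.1 Im.2.2 (v Im) = 0 → v Im = 0 := by
  induction k using Nat.strong_induction_on with
  | _ k ih =>
  rintro ⟨I₁, I₂, m⟩ hk v hvK hv0
  simp only at hk
  have hk2 : I₂.card = k := by
    rw [← hk, ← Fintype.card_coe, ← Fintype.card_coe]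
    exact (Fintype.card_congr m).symm
  have hle1 : I₁.card ≤ Fintype.card S₁ := Finset.card_le_univ _
  have hle2 : I₂.card ≤ Fintype.card S₂ := Finset.card_le_univ _
  have c1 : Fintype.card {x : S₁ // x ∉ I₁} = Fintype.card S₁ - k := by
    rw [Fintype.card_subtype_compl, Fintype.card_coe, hk]
  have c2 : Fintype.card {x : S₂ // x ∉ I₂} = Fintype.card S₂ - k := by
    rw [Fintype.card_subtype_compl, Fintype.card_coe, hk2]
  refine key_vanish n (S₁ := {x : S₁ // x ∉ I₁}) (S₂ := {y : S₂ // y ∉ I₂}) (by omega)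
    {w | ∃ v : (Im : MatchIdx S₁ S₂) →
      KSpace n {x : S₁ // x ∉ Im.1} {y : S₂ // y ∉ Im.2.1},
    (∀ Im : MatchIdx S₁ S₂, v Im ∈ Kcirc n {x : S₁ // x ∉ Im.1} {y : S₂ // y ∉ Im.2.1}) ∧
    ∑ Im : MatchIdx S₁ S₂, insertMany n Im.1 Im.2.1 Im.2.2 (v Im) = 0 ∧ v ⟨I₁, I₂, m⟩ = w} ?_ ?_ ?_ _
    ⟨v, hvK, hv0, rfl⟩
  · rintro _ ⟨v, hvK, -, rfl⟩
    exact hvK ⟨I₁, I₂, m⟩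
  · rintro _ ⟨v, hvK, hv0, rfl⟩ a b
    refine ⟨fun Im => Eop n a b (v Im), fun Im => Eop_mem_Kcirc n a b _ (hvK Im), ?_, rfl⟩
    have := congrArg (Eop n a b) hv0
    rw [map_sum, map_zero] at this
    rw [← this]
    exact Finset.sum_congr rfl fun Im _ => (Eop_insertMany n _ _ _ _ a b).symm
  · rintro _ ⟨v, hvK, hv0, rfl⟩ z hz
    classical
    have hcz : Fintype.card ↥I₁ ≤ Fintype.card {i : Fin n // i ∉ Finset.univ.image z} := by
      rw [Fintype.card_subtype_compl, Fintype.card_coe, Fintype.card_coe, Fintype.card_fin]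
      have : (Finset.univ.image z).card ≤ _ := Finset.card_image_le
      rw [Finset.card_univ, Fintype.card_sum, c1, c2] at this
      omega
    obtain ⟨f⟩ := Function.Embedding.nonempty_of_card_le hcz
    have hf : ∀ i x, z x ≠ (f i).1 := fun i x h => (f i).2 (by simp [← h])
    have hfi : ∀ i j, (f i).1 = (f j).1 → i = j := fun i j h => f.injective (Subtype.ext h)
    let ψ : S₁ ⊕ S₂ → Fin n := Sum.elim
      (fun x => if h : x ∈ I₁ then (f ⟨x, h⟩).1 else z (Sum.inl ⟨x, h⟩))
      (fun y => if h : y ∈ I₂ then (f (m.symm ⟨y, h⟩)).1 else z (Sum.inr ⟨y, h⟩))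
    have hψ : ∀ x y, ψ (Sum.inl x) = ψ (Sum.inr y) →
        ∃ h : x ∈ I₁, (m ⟨x, h⟩).1 = y := by
      intro x y h
      simp only [ψ, Sum.elim_inl, Sum.elim_inr] at h
      split_ifs at h with hx hy hy
      · refine ⟨hx, ?_⟩
        rw [hfi _ _ h]
        simp
      · exact absurd h.symm (hf _ _)
      · exact absurd h (hf _ _)
      · exact absurd h (hz _ _)
    have hres : resF I₁ I₂ ψ = z := by
      funext w
      rcases w with ⟨x, hx⟩ | ⟨y, hy⟩
      · simp [resF, ψ, hx]
      · simp [resF, ψ, hy]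
    have e := congrFun hv0 ψ
    rw [Finset.sum_apply, Finset.sum_eq_single ⟨I₁, I₂, m⟩] at e
    · rw [insertMany_apply, if_pos, hres] at e
      · exact e
      · rintro ⟨x, hx⟩
        simp [ψ, hx]
    · rintro ⟨J₁, J₂, m'⟩ _ hne
      by_cases hlt : J₁.card < k
      · rw [ih _ hlt ⟨J₁, J₂, m'⟩ rfl v hvK hv0]
        simp
      rw [insertMany_apply, if_neg]
      intro hc
      simp only at hc
      apply hne
      have hsub : J₁ ⊆ I₁ := fun x hx => (hψ _ _ (hc ⟨x, hx⟩)).1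
      have hJ : J₁ = I₁ := Finset.eq_of_subset_of_card_le hsub (by omega)
      subst hJ
      have hmm : ∀ x, (m' x).1 = (m x).1 := fun x => (hψ _ _ (hc x)).2.symm
      have hsub2 : J₂ ⊆ I₂ := fun y hy => by
        have := hmm (m'.symm ⟨y, hy⟩)
        rw [Equiv.apply_symm_apply] at this
        simp only at this
        rw [this]
        exact (m _).2
      have hc2 : J₂.card = J₁.card := by
        rw [← Fintype.card_coe, ← Fintype.card_coe]
        exact (Fintype.card_congr m').symm
      have hJ2 : J₂ = I₂ := Finset.eq_of_subset_of_card_le hsub2 (by omega)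
      subst hJ2
      have : m' = m := Equiv.ext fun x => Subtype.ext (hmm x)
      rw [this]
    · intro h; exact absurd (Finset.mem_univ _) h

theorem orth_decomp {ι : Type} [Fintype ι] (N : Submodule ℚ (ι → ℚ)) (x : ι → ℚ) :
    ∃ y ∈ N, ∀ u ∈ N, ∑ i, (x - y) i * u i = 0 := by
  classical
  let B : LinearMap.BilinForm ℚ (ι → ℚ) := LinearMap.mk₂ ℚ (fun u w => ∑ i, w i * u i)
    (by intro a b c; simp [mul_add, Finset.sum_add_distrib])
    (by intro a b c; simp [Finset.mul_sum, mul_left_comm])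
    (by intro a b c; simp [add_mul, Finset.sum_add_distrib])
    (by intro a b c; simp [Finset.mul_sum, mul_assoc])
  have hB : ∀ u w, B u w = ∑ i, w i * u i := fun u w => rfl
  have hrefl : B.IsRefl := by
    intro u w h
    rw [hB] at h ⊢
    rw [← h]
    exact Finset.sum_congr rfl fun i _ => mul_comm _ _
  have hc : IsCompl N (B.orthogonal N) := by
    rw [LinearMap.BilinForm.isCompl_orthogonal_iff_disjoint hrefl, Submodule.disjoint_def]
    intro u hu hu'
    have h : B u u = 0 := (LinearMap.BilinForm.mem_orthogonal_iff.1 hu') u hu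
    rw [hB, Finset.sum_eq_zero_iff_of_nonneg (fun i _ => mul_self_nonneg _)] at h
    funext i
    simpa using h i (Finset.mem_univ i)
  have hx : x ∈ N ⊔ B.orthogonal N := by rw [hc.sup_eq_top]; trivial
  obtain ⟨y, hy, z, hz, rfl⟩ := Submodule.mem_sup.1 hx
  refine ⟨y, hy, fun u hu => ?_⟩
  rw [add_sub_cancel_left]
  exact (LinearMap.BilinForm.mem_orthogonal_iff.1 hz) u hu

/-- Insertion of one copy of `ω(1)` in a basis tensor. -/
def genOne (n : ℕ) {S₁ S₂ : Type} [Fintype S₁] [Fintype S₂] [DecidableEq S₁] [DecidableEq S₂]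
    (s : S₁) (t : S₂) (φ : S₁ ⊕ S₂ → Fin n) : KSpace n S₁ S₂ := fun ψ =>
  ∑ i : Fin n,
    if ψ = Function.update (Function.update φ (Sum.inl s) i) (Sum.inr t) i then 1 else 0

theorem genOne_apply (n : ℕ) {S₁ S₂ : Type} [Fintype S₁] [Fintype S₂]
    [DecidableEq S₁] [DecidableEq S₂]
    (s : S₁) (t : S₂) (φ ψ : S₁ ⊕ S₂ → Fin n) :
    genOne n s t φ ψ = if ψ (Sum.inl s) = ψ (Sum.inr t) ∧
      (∀ x, x ≠ s → ψ (Sum.inl x) = φ (Sum.inl x)) ∧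
      (∀ y, y ≠ t → ψ (Sum.inr y) = φ (Sum.inr y)) then 1 else 0 := by
  have hiff : ∀ i, (ψ =
      Function.update (Function.update φ (Sum.inl s) i) (Sum.inr t) i) ↔
      ((ψ (Sum.inl s) = ψ (Sum.inr t) ∧
      (∀ x, x ≠ s → ψ (Sum.inl x) = φ (Sum.inl x)) ∧
      (∀ y, y ≠ t → ψ (Sum.inr y) = φ (Sum.inr y))) ∧ i = ψ (Sum.inl s)) := by
    intro i
    rw [funext_iff, Sum.forall]
    simp only [Function.update_apply, reduceCtorEq, if_false, Sum.inl.injEq, Sum.inr.injEq]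
    constructor
    · rintro ⟨h1, h2⟩
      have h3 := h1 s
      have h4 := h2 t
      simp only [if_true] at h3 h4
      refine ⟨⟨h3.trans h4.symm, fun x hx => ?_, fun y hy => ?_⟩, h3.symm⟩
      · simpa [hx] using h1 x
      · simpa [hy] using h2 y
    · rintro ⟨⟨h1, h2, h3⟩, h4⟩
      refine ⟨fun x => ?_, fun y => ?_⟩
      · split_ifs with h
        · rw [h, h4]
        · exact h2 x h
      · split_ifs with h
        · rw [h, h4, h1]
        · exact h3 y h
  simp only [genOne]
  rw [Finset.sum_congr rfl fun i _ => if_congr (hiff i) rfl rfl]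
  by_cases h : ψ (Sum.inl s) = ψ (Sum.inr t) ∧
      (∀ x, x ≠ s → ψ (Sum.inl x) = φ (Sum.inl x)) ∧
      (∀ y, y ≠ t → ψ (Sum.inr y) = φ (Sum.inr y))
  · rw [if_pos h]
    rw [Finset.sum_congr rfl fun i _ => if_congr (and_iff_right h) rfl rfl]
    simp
  · rw [if_neg h]
    exact Finset.sum_eq_zero fun i _ => if_neg fun h' => h h'.1

theorem span_decomp (n : ℕ) {S₁ S₂ : Type} [Fintype S₁] [Fintype S₂]
    [DecidableEq S₁] [DecidableEq S₂] (x : KSpace n S₁ S₂) :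
    ∃ y ∈ Submodule.span ℚ {w | ∃ s t φ, w = genOne n (S₁ := S₁) (S₂ := S₂) s t φ},
      x - y ∈ Kcirc n S₁ S₂ := by
  obtain ⟨y, hy, h⟩ := orth_decomp
    (Submodule.span ℚ {w | ∃ s t φ, w = genOne n (S₁ := S₁) (S₂ := S₂) s t φ}) x
  refine ⟨y, hy, (mem_Kcirc_iff n _).2 fun s t φ => ?_⟩
  rw [← h _ (Submodule.subset_span ⟨s, t, φ, rfl⟩)]
  simp only [genOne, Finset.mul_sum]
  rw [Finset.sum_comm]
  refine Finset.sum_congr rfl fun i _ => ?_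
  simp only [mul_ite, mul_one, mul_zero, Finset.sum_ite_eq', Finset.mem_univ, if_true]

theorem exists_insert_equiv {S₁ S₂ : Type} [DecidableEq S₁] [DecidableEq S₂]
    (I₁ : Finset S₁) (I₂ : Finset S₂) (m : ↥I₁ ≃ ↥I₂) (s : S₁) (t : S₂) (hs : s ∉ I₁)
    (ht : t ∉ I₂) :
    ∃ m' : ↥(insert s I₁) ≃ ↥(insert t I₂),
      (m' ⟨s, Finset.mem_insert_self _ _⟩).1 = t ∧
      ∀ a : ↥I₁, (m' ⟨a.1, Finset.mem_insert_of_mem a.2⟩).1 = (m a).1 := by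
  refine ⟨(Finset.subtypeInsertEquivOption hs).trans
    ((Equiv.optionCongr m).trans (Finset.subtypeInsertEquivOption ht).symm), ?_, ?_⟩
  · simp [Finset.subtypeInsertEquivOption]
  · rintro ⟨a, ha⟩
    have : a ≠ s := fun h => hs (h ▸ ha)
    simp [Finset.subtypeInsertEquivOption, this]

theorem insertMany_genOne (n : ℕ) {S₁ S₂ : Type} [Fintype S₁] [Fintype S₂] [DecidableEq S₁]
    [DecidableEq S₂] (I₁ : Finset S₁) (I₂ : Finset S₂) (m : ↥I₁ ≃ ↥I₂)
    (s : {x : S₁ // x ∉ I₁}) (t : {y : S₂ // y ∉ I₂})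
    (φ : {x : S₁ // x ∉ I₁} ⊕ {y : S₂ // y ∉ I₂} → Fin n) :
    ∃ m' : ↥(insert s.1 I₁) ≃ ↥(insert t.1 I₂),
      insertMany n I₁ I₂ m (genOne n s t φ) ∈
        LinearMap.range (insertMany n (insert s.1 I₁) (insert t.1 I₂) m') := by
  classical
  obtain ⟨m', hm1, hm2⟩ := exists_insert_equiv I₁ I₂ m s.1 t.1 s.2 t.2
  refine ⟨m', fun χ => if
    (∀ x (hx : x ∉ insert s.1 I₁), χ (Sum.inl ⟨x, hx⟩) =
      φ (Sum.inl ⟨x, fun h => hx (Finset.mem_insert_of_mem h)⟩)) ∧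
    (∀ x (hx : x ∉ insert t.1 I₂), χ (Sum.inr ⟨x, hx⟩) =
      φ (Sum.inr ⟨x, fun h => hx (Finset.mem_insert_of_mem h)⟩)) then 1 else 0, ?_⟩
  funext ψ
  rw [insertMany_apply, insertMany_apply, genOne_apply, ← ite_and, ← ite_and]
  refine if_congr ?_ rfl rfl
  have e1 : (∀ a : ↥(insert s.1 I₁), ψ (Sum.inl a.1) = ψ (Sum.inr (m' a).1)) ↔
      (ψ (Sum.inl s.1) = ψ (Sum.inr t.1) ∧
        ∀ a : ↥I₁, ψ (Sum.inl a.1) = ψ (Sum.inr (m a).1)) := by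
    constructor
    · intro h
      refine ⟨?_, fun a => ?_⟩
      · rw [← hm1]; exact h ⟨s.1, Finset.mem_insert_self _ _⟩
      · rw [← hm2]; exact h ⟨a.1, Finset.mem_insert_of_mem a.2⟩
    · rintro ⟨h1, h2⟩ ⟨a, ha⟩
      rcases Finset.mem_insert.1 ha with rfl | ha'
      · rw [hm1]; exact h1
      · exact (h2 ⟨a, ha'⟩).trans (by rw [← hm2])
  rw [e1]
  simp only [resF, Sum.elim_inl, Sum.elim_inr, Finset.mem_insert, not_or, Subtype.forall, ne_eq,
    Subtype.ext_iff]
  constructor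
  · rintro ⟨⟨h1, h2⟩, h3, h4⟩
    exact ⟨h2, h1, fun x hx hxs => h3 x ⟨hxs, hx⟩, fun x hx hxs => h4 x ⟨hxs, hx⟩⟩
  · rintro ⟨h2, h1, h3, h4⟩
    exact ⟨⟨h1, h2⟩, fun x hx => h3 x hx.2 hx.1, fun x hx => h4 x hx.2 hx.1⟩

theorem range_le_iSup (n : ℕ) (S₁ S₂ : Type)
    [Fintype S₁] [Fintype S₂] [DecidableEq S₁] [DecidableEq S₂] (d : ℕ) :
    ∀ Im : MatchIdx S₁ S₂, Fintype.card S₁ - Im.1.card = d →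
    LinearMap.range (insertMany n Im.1 Im.2.1 Im.2.2) ≤
      ⨆ Im : MatchIdx S₁ S₂, Submodule.map (insertMany n Im.1 Im.2.1 Im.2.2)
          (Kcirc n {x : S₁ // x ∉ Im.1} {y : S₂ // y ∉ Im.2.1}) := by
  induction d using Nat.strong_induction_on with
  | _ d ih =>
  rintro ⟨I₁, I₂, m⟩ hd
  rintro _ ⟨x, rfl⟩
  obtain ⟨y, hy, hxy⟩ := span_decomp n x
  rw [← sub_add_cancel x y, map_add]
  refine Submodule.add_mem _ ?_ ?_
  · exact Submodule.mem_iSup_of_mem (⟨I₁, I₂, m⟩ : MatchIdx S₁ S₂)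
      (Submodule.mem_map_of_mem hxy)
  · refine (Submodule.span_le (p := Submodule.comap (insertMany n I₁ I₂ m)
      (⨆ Im : MatchIdx S₁ S₂, Submodule.map (insertMany n Im.1 Im.2.1 Im.2.2)
          (Kcirc n {x : S₁ // x ∉ Im.1} {y : S₂ // y ∉ Im.2.1})))).2 ?_ hy
    rintro _ ⟨s, t, φ, rfl⟩
    obtain ⟨m', hm'⟩ := insertMany_genOne n I₁ I₂ m s t φ
    refine ih _ ?_ ⟨insert s.1 I₁, insert t.1 I₂, m'⟩ rfl hm'
    have h1 : (insert s.1 I₁).card ≤ Fintype.card S₁ := Finset.card_le_univ _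
    simp only [Finset.card_insert_of_notMem s.2] at h1 ⊢
    simp only at hd
    omega

theorem statement_2 (n : ℕ) (hn : 0 < n) (S₁ S₂ : Type)
    [Fintype S₁] [Fintype S₂] [DecidableEq S₁] [DecidableEq S₂]
    (hcard : Fintype.card S₁ + Fintype.card S₂ ≤ n) :
    DirectSum.IsInternal
      (fun Im : Σ (I₁ : Finset S₁) (I₂ : Finset S₂), (↥I₁ ≃ ↥I₂) =>
        Submodule.map (insertMany n Im.1 Im.2.1 Im.2.2)
          (Kcirc n {x : S₁ // x ∉ Im.1} {y : S₂ // y ∉ Im.2.1})) := by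

  rw [DirectSum.isInternal_submodule_iff_iSupIndep_and_iSup_eq_top]
  constructor
  · refine iSupIndep_of_dfinsupp_lsum_injective _ ?_
    rw [injective_iff_map_eq_zero]
    intro x hx
    have hx' : ∑ Im : MatchIdx S₁ S₂, (x Im : KSpace n S₁ S₂) = 0 := by
      rw [← hx, DFinsupp.lsum_apply_apply, DFinsupp.sumAddHom_apply, DFinsupp.sum_eq_sum_fintype]
      · rfl
      · intro i; simp
    choose u hu1 hu2 using fun Im : MatchIdx S₁ S₂ => (Submodule.mem_map.1 (x Im).2)
    have hz : ∀ Im, u Im = 0 := fun Im => rel_zero n S₁ S₂ hcard _ Im rfl u hu1 (by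
      rw [← hx']
      exact Finset.sum_congr rfl fun Im _ => hu2 Im)
    ext1 Im
    apply Subtype.ext
    rw [← hu2 Im, hz Im]
    simp
  · rw [eq_top_iff]
    let e : MatchIdx S₁ S₂ := ⟨∅, ∅, Equiv.equivOfIsEmpty _ _⟩
    refine le_trans ?_ (range_le_iSup n S₁ S₂ _ e rfl)
    rintro x -
    refine ⟨fun χ => x (Sum.elim (fun a => χ (Sum.inl ⟨a, by simp [e]⟩))
      (fun a => χ (Sum.inr ⟨a, by simp [e]⟩))), ?_⟩
    funext ψ
    rw [insertMany_apply, if_pos]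
    · congr 1
      funext z
      rcases z with z | z <;> rfl
    · intro a
      exact absurd a.2 (Finset.notMem_empty a.1)
end

section
/- Let n be a positive integer and S = (S₁,S₂) a pair of finite sets with n ≥ |S₁| + |S₂| + 3. Then the linear map from the free ℚ-vector space on the set of bipartite matchings of S to K_S(n)^{GL_n(ℤ)}, sending a matching m to ω_m(1), is an isomorphism. In particular, if |S₁| = |S₂| = p then the elements ω_m(1) are linearly independent and dim_ℚ K_S(n)^{GL_n(ℤ)} = p!. -/
/-!
Statement 4: For `n ≥ |S₁| + |S₂| + 3`, the linear map from the free ℚ-vector space on the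
set of bipartite matchings of `S` to `K_S(n)^{GL_n(ℤ)}`, sending `m` to `ω_m(1)`, is an
isomorphism; in particular if `|S₁| = |S₂| = p` the `ω_m(1)` are linearly independent and
the invariants have dimension `p!`.
-/

open scoped BigOperators

/-- The action of `g ∈ GL_n(ℤ)` on `K_S(n)`: the standard action on each `H`-factor and the
contragredient action on each `H∨`-factor, written out on coordinates. -/
def glAction (n : ℕ) {S₁ S₂ : Type} [Fintype S₁] [Fintype S₂]
    [DecidableEq S₁] [DecidableEq S₂] (g : GL (Fin n) ℤ) :
    KSpace n S₁ S₂ →ₗ[ℚ] KSpace n S₁ S₂ where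
  toFun T := fun ψ => ∑ χ : (S₁ ⊕ S₂) → Fin n,
      ((∏ s : S₁, ((g : Matrix (Fin n) (Fin n) ℤ) (ψ (Sum.inl s)) (χ (Sum.inl s)) : ℚ)) *
       (∏ t : S₂, (((g⁻¹ : GL (Fin n) ℤ) : Matrix (Fin n) (Fin n) ℤ)
          (χ (Sum.inr t)) (ψ (Sum.inr t)) : ℚ))) * T χ
  map_add' T T' := by
    funext ψ
    simp [mul_add, Finset.sum_add_distrib]
  map_smul' a T := by
    funext ψ
    simp only [Pi.smul_apply, smul_eq_mul, RingHom.id_apply]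
    rw [Finset.mul_sum]
    exact Finset.sum_congr rfl fun _ _ => by ring

/-- The submodule of `GL_n(ℤ)`-invariant tensors in `K_S(n)`. -/
def glInvariants (n : ℕ) (S₁ S₂ : Type) [Fintype S₁] [Fintype S₂]
    [DecidableEq S₁] [DecidableEq S₂] : Submodule ℚ (KSpace n S₁ S₂) :=
  ⨅ g : GL (Fin n) ℤ, LinearMap.eqLocus (glAction n (S₁ := S₁) (S₂ := S₂) g) LinearMap.id

/-- The invariant tensor `ω_m(1) ∈ K_S(n)` attached to a bipartite matching (bijection)
`m : S₁ ≃ S₂`; its coordinate at `ψ` is `1` if `ψ` matches along `m` and `0` otherwise. -/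
def omegaM (n : ℕ) {S₁ S₂ : Type} [Fintype S₁] [DecidableEq (Fin n)] (m : S₁ ≃ S₂) :
    KSpace n S₁ S₂ :=
  fun ψ => if ∀ s : S₁, ψ (Sum.inl s) = ψ (Sum.inr (m s)) then 1 else 0

theorem s4_lie {X : Type} [Fintype X] [DecidableEq X] (n : ℕ)
    (T : (X → Fin n) → ℚ) (N : X → Fin n → Fin n → ℚ) (ψ : X → Fin n)
    (h : ∀ k : ℤ, ∑ χ : X → Fin n,
      (∏ x, ((if ψ x = χ x then 1 else 0) + (k : ℚ) * N x (ψ x) (χ x))) * T χ = T ψ) :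
    ∑ x, ∑ b, N x (ψ x) b * T (Function.update ψ x b) = 0 := by
  classical
  let P : Polynomial ℚ := ∑ χ : X → Fin n,
      (∏ x, (Polynomial.C (if ψ x = χ x then 1 else 0) + Polynomial.X * Polynomial.C (N x (ψ x) (χ x))))
        * Polynomial.C (T χ)
  have hP : P = Polynomial.C (T ψ) := by
    apply Polynomial.eq_of_infinite_eval_eq
    apply Set.Infinite.mono (s := Set.range (fun k : ℤ => (k : ℚ)))
    · rintro _ ⟨k, rfl⟩
      simp only [Set.mem_ofPred_eq, P, Polynomial.eval_finsetSum, Polynomial.eval_mul,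
        Polynomial.eval_prod, Polynomial.eval_add, Polynomial.eval_C, Polynomial.eval_X]
      exact h k
    · exact Set.infinite_range_of_injective Int.cast_injective
  have hd : Polynomial.eval 0 (Polynomial.derivative P) = 0 := by rw [hP]; simp
  simp only [P, Polynomial.derivative_sum, Polynomial.derivative_mul, Polynomial.derivative_C,
    mul_zero, add_zero, Polynomial.derivative_prod_finset, Polynomial.derivative_add, zero_add,
    Polynomial.derivative_X, one_mul, Polynomial.eval_finsetSum, Polynomial.eval_mul,
        Polynomial.eval_prod, Polynomial.eval_add, Polynomial.eval_C, Polynomial.eval_X,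
        zero_mul] at hd
  refine Eq.trans ?_ hd
  simp only [Finset.sum_mul]
  refine Eq.trans ?_ Finset.sum_comm
  refine Finset.sum_congr rfl fun x _ => ?_
  symm
  rw [← Finset.sum_subset (Finset.subset_univ (Finset.univ.image (fun b => Function.update ψ x b)))]
  · rw [Finset.sum_image]
    · refine Finset.sum_congr rfl fun b _ => ?_
      rw [Finset.prod_eq_one]
      · simp
      · intro y hy
        have : y ≠ x := (Finset.mem_erase.1 hy).1
        simp [Function.update_of_ne this]
    · intro b _ c _ hbc
      simpa using congrFun hbc x
  · intro χ _ hχ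
    have : ∃ y, y ≠ x ∧ ψ y ≠ χ y := by
      by_contra hcon
      push Not at hcon
      apply hχ
      rw [Finset.mem_image]
      refine ⟨χ x, Finset.mem_univ _, ?_⟩
      funext y
      by_cases hy : y = x
      · subst hy; simp
      · rw [Function.update_of_ne hy, hcon y hy]
    obtain ⟨y, hy, hne⟩ := this
    rw [Finset.prod_eq_zero (i := y)]
    · simp
    · simp [hy]
    · simp [hne]

theorem s4_inv (n : ℕ) {S₁ S₂ : Type} [Fintype S₁] [Fintype S₂]
    [DecidableEq S₁] [DecidableEq S₂] {T : KSpace n S₁ S₂} (hT : T ∈ glInvariants n S₁ S₂)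
    (g : GL (Fin n) ℤ) (ψ : S₁ ⊕ S₂ → Fin n) :
    ∑ χ : (S₁ ⊕ S₂) → Fin n,
      ((∏ s : S₁, ((g : Matrix (Fin n) (Fin n) ℤ) (ψ (Sum.inl s)) (χ (Sum.inl s)) : ℚ)) *
       (∏ t : S₂, (((g⁻¹ : GL (Fin n) ℤ) : Matrix (Fin n) (Fin n) ℤ)
          (χ (Sum.inr t)) (ψ (Sum.inr t)) : ℚ))) * T χ = T ψ := by
  have := (Submodule.mem_iInf _).1 hT g
  exact congrFun this ψ

/-- the infinitesimal action of `E_ij` -/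
theorem s4_E (n : ℕ) {S₁ S₂ : Type} [Fintype S₁] [Fintype S₂]
    [DecidableEq S₁] [DecidableEq S₂] {T : KSpace n S₁ S₂} (hT : T ∈ glInvariants n S₁ S₂)
    (i j : Fin n) (hij : i ≠ j) (χ : S₁ ⊕ S₂ → Fin n) :
    ∑ s : S₁, (if χ (Sum.inl s) = i then T (Function.update χ (Sum.inl s) j) else 0) =
    ∑ t : S₂, (if χ (Sum.inr t) = j then T (Function.update χ (Sum.inr t) i) else 0) := by
  have key := s4_lie n T (fun x a b => Sum.elim
    (fun _ : S₁ => if i = a ∧ j = b then (1 : ℚ) else 0)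
    (fun _ : S₂ => if i = b ∧ j = a then (-1 : ℚ) else 0) x) χ ?_
  · rw [Fintype.sum_sum_type] at key
    simp only [Sum.elim_inl, Sum.elim_inr, ite_and, ite_mul, neg_mul, one_mul, zero_mul,
      Finset.sum_ite_eq, Finset.mem_univ, if_true] at key
    have e1 : ∀ s : S₁, (∑ b, if i = χ (Sum.inl s) then
        (if j = b then T (Function.update χ (Sum.inl s) b) else 0) else 0) =
        (if χ (Sum.inl s) = i then T (Function.update χ (Sum.inl s) j) else 0) := by
      intro s
      by_cases h : χ (Sum.inl s) = i
      · simp [h]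
      · simp [h, Ne.symm h]
    have e2 : ∀ t : S₂, (if j = χ (Sum.inr t) then -T (Function.update χ (Sum.inr t) i) else 0) =
        -(if χ (Sum.inr t) = j then T (Function.update χ (Sum.inr t) i) else 0) := by
      intro t
      by_cases h : χ (Sum.inr t) = j
      · simp [h]
      · simp [h, Ne.symm h]
    simp only [e1, e2, Finset.sum_neg_distrib] at key
    linarith
  · intro k
    have hmul : ∀ a b : ℤ, a + b = 0 → (1 + Matrix.single i j a : Matrix (Fin n) (Fin n) ℤ) *
        (1 + Matrix.single i j b) = 1 := by
      intro a b hab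
      have := Matrix.transvection_mul_transvection_same i j hij a b
      rw [hab, Matrix.transvection_zero] at this
      exact this
    let g : GL (Fin n) ℤ := ⟨1 + Matrix.single i j k, 1 + Matrix.single i j (-k),
      hmul _ _ (by ring), hmul _ _ (by ring)⟩
    rw [← s4_inv n hT g χ]
    refine Finset.sum_congr rfl fun φ _ => ?_
    rw [Fintype.prod_sum_type]
    congr 2
    · refine Finset.prod_congr rfl fun s _ => ?_
      change _ = (((1 + Matrix.single i j k : Matrix (Fin n) (Fin n) ℤ) _ _ : ℤ) : ℚ)
      simp only [Matrix.add_apply, Matrix.one_apply, Matrix.single_apply, Sum.elim_inl]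
      push_cast
      simp
    · refine Finset.prod_congr rfl fun t _ => ?_
      change _ = (((1 + Matrix.single i j (-k) : Matrix (Fin n) (Fin n) ℤ) _ _ : ℤ) : ℚ)
      simp only [Matrix.add_apply, Matrix.one_apply, Matrix.single_apply, Sum.elim_inr,
        eq_comm (a := χ (Sum.inr t))]
      push_cast
      simp

theorem s4_L1 (n : ℕ) {S₁ S₂ : Type} [Fintype S₁] [Fintype S₂]
    [DecidableEq S₁] [DecidableEq S₂] {T : KSpace n S₁ S₂} (hT : T ∈ glInvariants n S₁ S₂)
    (ψ : S₁ ⊕ S₂ → Fin n) (j : Fin n) (hj : ∀ x, ψ x ≠ j) (t₀ : S₂) :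
    T ψ = ∑ s : S₁, if ψ (Sum.inl s) = ψ (Sum.inr t₀) then
      T (Function.update (Function.update ψ (Sum.inr t₀) j) (Sum.inl s) j) else 0 := by
  have h := s4_E n hT (ψ (Sum.inr t₀)) j (hj _) (Function.update ψ (Sum.inr t₀) j)
  rw [Finset.sum_eq_single (a := t₀) (s := (Finset.univ : Finset S₂))] at h
  · simp only [Function.update_self, if_true, Function.update_idem, Function.update_eq_self] at h
    rw [← h]
    refine Finset.sum_congr rfl fun s _ => ?_
    rw [Function.update_of_ne (by simp : (Sum.inl s : S₁ ⊕ S₂) ≠ Sum.inr t₀)]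
  · intro t _ ht
    rw [Function.update_of_ne (by simpa using ht : (Sum.inr t : S₁ ⊕ S₂) ≠ Sum.inr t₀),
      if_neg (hj _)]
  · simp

theorem s4_L2 (n : ℕ) {S₁ S₂ : Type} [Fintype S₁] [Fintype S₂]
    [DecidableEq S₁] [DecidableEq S₂] {T : KSpace n S₁ S₂} (hT : T ∈ glInvariants n S₁ S₂)
    (ψ : S₁ ⊕ S₂ → Fin n) (j : Fin n) (hj : ∀ x, ψ x ≠ j) (s₀ : S₁) :
    T ψ = ∑ t : S₂, if ψ (Sum.inr t) = ψ (Sum.inl s₀) then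
      T (Function.update (Function.update ψ (Sum.inr t) j) (Sum.inl s₀) j) else 0 := by
  have h := s4_E n hT j (ψ (Sum.inl s₀)) (hj _).symm (Function.update ψ (Sum.inl s₀) j)
  rw [Finset.sum_eq_single (a := s₀) (s := (Finset.univ : Finset S₁))] at h
  · simp only [Function.update_self, if_true, Function.update_idem, Function.update_eq_self] at h
    rw [h]
    refine Finset.sum_congr rfl fun t _ => ?_
    rw [Function.update_of_ne (by simp : (Sum.inr t : S₁ ⊕ S₂) ≠ Sum.inl s₀),
      Function.update_comm (by simp : (Sum.inr t : S₁ ⊕ S₂) ≠ Sum.inl s₀)]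
  · intro t _ ht
    rw [Function.update_of_ne (by simpa using ht : (Sum.inl t : S₁ ⊕ S₂) ≠ Sum.inl s₀),
      if_neg (hj _)]
  · simp

theorem s4_balance (n : ℕ) {S₁ S₂ : Type} [Fintype S₁] [Fintype S₂]
    [DecidableEq S₁] [DecidableEq S₂] {T : KSpace n S₁ S₂} (hT : T ∈ glInvariants n S₁ S₂)
    (ψ : S₁ ⊕ S₂ → Fin n) (j : Fin n) (hj : ∀ x, ψ x ≠ j) (hne : T ψ ≠ 0) (i : Fin n) :
    (Finset.univ.filter (fun s : S₁ => ψ (Sum.inl s) = i)).card =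
    (Finset.univ.filter (fun t : S₂ => ψ (Sum.inr t) = i)).card := by
  have h1 : ((Finset.univ.filter (fun s : S₁ => ψ (Sum.inl s) = i)).card : ℚ) * T ψ =
      ∑ s : S₁, ∑ t : S₂, if ψ (Sum.inl s) = i ∧ ψ (Sum.inr t) = i then
      T (Function.update (Function.update ψ (Sum.inr t) j) (Sum.inl s) j) else 0 := by
    rw [← nsmul_eq_mul, ← Finset.sum_const, Finset.sum_filter]
    refine Finset.sum_congr rfl fun s _ => ?_
    by_cases h : ψ (Sum.inl s) = i
    · rw [if_pos h, s4_L2 n hT ψ j hj s]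
      simp [h]
    · simp [h]
  have h2 : ((Finset.univ.filter (fun t : S₂ => ψ (Sum.inr t) = i)).card : ℚ) * T ψ =
      ∑ s : S₁, ∑ t : S₂, if ψ (Sum.inl s) = i ∧ ψ (Sum.inr t) = i then
      T (Function.update (Function.update ψ (Sum.inr t) j) (Sum.inl s) j) else 0 := by
    rw [Finset.sum_comm, ← nsmul_eq_mul, ← Finset.sum_const, Finset.sum_filter]
    refine Finset.sum_congr rfl fun t _ => ?_
    by_cases h : ψ (Sum.inr t) = i
    · rw [if_pos h, s4_L1 n hT ψ j hj t]
      simp [h]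
    · simp [h]
  exact_mod_cast mul_right_cancel₀ hne (h1.trans h2.symm)

theorem s4_perm (n : ℕ) {S₁ S₂ : Type} [Fintype S₁] [Fintype S₂]
    [DecidableEq S₁] [DecidableEq S₂] {T : KSpace n S₁ S₂} (hT : T ∈ glInvariants n S₁ S₂)
    (σ : Equiv.Perm (Fin n)) (ψ : S₁ ⊕ S₂ → Fin n) : T (σ ∘ ψ) = T ψ := by
  have hmul : ∀ τ ρ : Equiv.Perm (Fin n), (∀ a, ρ (τ a) = a) →
      (Matrix.of (fun a b => if τ a = b then (1 : ℤ) else 0)) *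
        (Matrix.of (fun a b => if ρ a = b then (1 : ℤ) else 0)) = 1 := by
    intro τ ρ h
    ext a b
    rw [Matrix.mul_apply, Finset.sum_eq_single (τ a)]
    · simp [Matrix.one_apply, h]
    · intro c _ hc
      simp [Ne.symm hc]
    · simp
  let g : GL (Fin n) ℤ := ⟨_, _, hmul σ σ.symm (by simp), hmul σ.symm σ (by simp)⟩
  rw [← s4_inv n hT g ψ, Finset.sum_eq_single (σ ∘ ψ)]
  · have e1 : ∀ s : S₁, (g : Matrix (Fin n) (Fin n) ℤ) (ψ (Sum.inl s)) ((σ ∘ ψ) (Sum.inl s)) = 1 := by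
      intro s
      change (if _ then (1 : ℤ) else 0) = 1
      simp
    have e2 : ∀ t : S₂, ((g⁻¹ : GL (Fin n) ℤ) : Matrix (Fin n) (Fin n) ℤ)
        ((σ ∘ ψ) (Sum.inr t)) (ψ (Sum.inr t)) = 1 := by
      intro s
      change (if _ then (1 : ℤ) else 0) = 1
      simp
    simp only [e1, e2]
    simp
  · intro χ _ hχ
    obtain ⟨x, hx⟩ := Function.ne_iff.1 hχ
    cases x with
    | inl s =>
      have : (g : Matrix (Fin n) (Fin n) ℤ) (ψ (Sum.inl s)) (χ (Sum.inl s)) = 0 := by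
        change (if _ then (1 : ℤ) else 0) = 0
        rw [if_neg]
        exact fun h => hx h.symm
      rw [Finset.prod_eq_zero (Finset.mem_univ s) (by rw [this]; simp)]
      simp
    | inr t =>
      have : ((g⁻¹ : GL (Fin n) ℤ) : Matrix (Fin n) (Fin n) ℤ) (χ (Sum.inr t)) (ψ (Sum.inr t)) = 0 := by
        change (if _ then (1 : ℤ) else 0) = 0
        rw [if_neg]
        intro h
        apply hx
        simp [← h]
      rw [Finset.prod_eq_zero (s := (Finset.univ : Finset S₂)) (Finset.mem_univ t) (by rw [this]; simp)]
      simp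
  · simp

theorem s4_vanish (n : ℕ) {S₁ S₂ : Type} [Fintype S₁] [Fintype S₂]
    [DecidableEq S₁] [DecidableEq S₂] (hc : Fintype.card S₁ + Fintype.card S₂ < n)
    {T : KSpace n S₁ S₂} (hT : T ∈ glInvariants n S₁ S₂)
    (h0 : ∀ (m : S₁ ≃ S₂) (ι : S₁ → Fin n), Function.Injective ι →
      T (Sum.elim ι (ι ∘ m.symm)) = 0) : T = 0 := by
  have hfree : ∀ ψ : S₁ ⊕ S₂ → Fin n, ∃ j, ∀ x, ψ x ≠ j := by
    intro ψ
    by_contra hcon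
    push Not at hcon
    have := Fintype.card_le_of_surjective ψ hcon
    simp at this
    omega
  have main : ∀ (d : ℕ) (ψ : S₁ ⊕ S₂ → Fin n),
      n ≤ d + (Finset.univ.image (ψ ∘ Sum.inl)).card → T ψ = 0 := by
    intro d
    induction d with
    | zero =>
      intro ψ h
      have : (Finset.univ.image (ψ ∘ Sum.inl)).card ≤ Fintype.card S₁ := Finset.card_image_le
      omega
    | succ d ih =>
      intro ψ h
      by_contra hne
      obtain ⟨j, hj⟩ := hfree ψ
      have hbal := s4_balance n hT ψ j hj hne
      by_cases hinj : Function.Injective (ψ ∘ Sum.inl)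
      · have hinj2 : Function.Injective (ψ ∘ Sum.inr) := by
          intro t t' htt
          have h1 := hbal (ψ (Sum.inr t))
          have h2 : (Finset.univ.filter (fun s : S₁ => ψ (Sum.inl s) = ψ (Sum.inr t))).card ≤ 1 := by
            rw [Finset.card_le_one]
            intro a ha b hb
            simp only [Finset.mem_filter, Finset.mem_univ, true_and] at ha hb
            exact hinj (ha.trans hb.symm)
          rw [h1, Finset.card_le_one] at h2
          exact h2 t (by simp) t' (by simpa using htt.symm)
        have hex : ∀ s : S₁, ∃ t : S₂, ψ (Sum.inr t) = ψ (Sum.inl s) := by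
          intro s
          have h1 := hbal (ψ (Sum.inl s))
          have h2 : 0 < (Finset.univ.filter (fun s' : S₁ => ψ (Sum.inl s') = ψ (Sum.inl s))).card :=
            Finset.card_pos.2 ⟨s, by simp⟩
          rw [h1] at h2
          obtain ⟨t, ht⟩ := Finset.card_pos.1 h2
          exact ⟨t, by simpa using ht⟩
        have hex2 : ∀ t : S₂, ∃ s : S₁, ψ (Sum.inl s) = ψ (Sum.inr t) := by
          intro s
          have h1 := hbal (ψ (Sum.inr s))
          have h2 : 0 < (Finset.univ.filter (fun s' : S₂ => ψ (Sum.inr s') = ψ (Sum.inr s))).card :=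
            Finset.card_pos.2 ⟨s, by simp⟩
          rw [← h1] at h2
          obtain ⟨t, ht⟩ := Finset.card_pos.1 h2
          exact ⟨t, by simpa using ht⟩
        choose f hf using hex
        choose f' hf' using hex2
        let m : S₁ ≃ S₂ := ⟨f, f', fun s => hinj (by simp [hf', hf]), fun t => hinj2 (by simp [hf', hf])⟩
        apply hne
        rw [← h0 m _ hinj]
        congr 1
        funext x
        cases x with
        | inl s => rfl
        | inr t => exact (hf' t).symm
      · simp only [Function.Injective] at hinj
        push Not at hinj
        obtain ⟨a, b, hab, hne'⟩ := hinj
        have h1 := hbal (ψ (Sum.inl a))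
        have h2 : 0 < (Finset.univ.filter (fun s' : S₁ => ψ (Sum.inl s') = ψ (Sum.inl a))).card :=
            Finset.card_pos.2 ⟨a, by simp⟩
        rw [h1] at h2
        obtain ⟨t, ht⟩ := Finset.card_pos.1 h2
        simp only [Finset.mem_filter, Finset.mem_univ, true_and] at ht
        apply hne
        rw [s4_L1 n hT ψ j hj t]
        apply Finset.sum_eq_zero
        intro s _
        split_ifs with hs
        swap
        · rfl
        apply ih
        have hsub : insert j (Finset.univ.image (ψ ∘ Sum.inl)) ⊆ Finset.univ.image
            (Function.update (Function.update ψ (Sum.inr t) j) (Sum.inl s) j ∘ Sum.inl) := by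
          intro y hy
          rw [Finset.mem_insert, Finset.mem_image] at hy
          rw [Finset.mem_image]
          have hupd : ∀ c, c ≠ s → (Function.update (Function.update ψ (Sum.inr t) j) (Sum.inl s) j ∘ Sum.inl) c
              = ψ (Sum.inl c) := by
            intro c hc
            simp [Function.update, hc]
          rcases hy with rfl | ⟨c, _, rfl⟩
          · exact ⟨s, by simp⟩
          · by_cases hc : c = s
            · subst hc
              by_cases hca : c = a
              · subst hca
                exact ⟨b, Finset.mem_univ _, by rw [hupd b (Ne.symm hne')]; exact hab.symm⟩
              · exact ⟨a, Finset.mem_univ _, by rw [hupd a (Ne.symm hca)]; exact ht.symm.trans hs.symm⟩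
            · exact ⟨c, Finset.mem_univ _, hupd c hc⟩
        have := Finset.card_le_card hsub
        rw [Finset.card_insert_of_notMem] at this
        · omega
        · simp only [Finset.mem_image, not_exists]
          rintro c ⟨_, hc⟩
          exact hj _ hc
  funext ψ
  exact main n ψ (by omega)

theorem s4_omega_inv (n : ℕ) {S₁ S₂ : Type} [Fintype S₁] [Fintype S₂]
    [DecidableEq S₁] [DecidableEq S₂] (m : S₁ ≃ S₂) : omegaM n m ∈ glInvariants n S₁ S₂ := by
  rw [glInvariants, Submodule.mem_iInf]
  intro g
  change glAction n g (omegaM n m) = omegaM n m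
  funext ψ
  change ∑ χ : (S₁ ⊕ S₂) → Fin n,
      ((∏ s : S₁, ((g : Matrix (Fin n) (Fin n) ℤ) (ψ (Sum.inl s)) (χ (Sum.inl s)) : ℚ)) *
       (∏ t : S₂, (((g⁻¹ : GL (Fin n) ℤ) : Matrix (Fin n) (Fin n) ℤ)
          (χ (Sum.inr t)) (ψ (Sum.inr t)) : ℚ))) * omegaM n m χ = omegaM n m ψ
  have hprod : omegaM n m ψ = ∏ s : S₁, ∑ b : Fin n,
      ((g : Matrix (Fin n) (Fin n) ℤ) (ψ (Sum.inl s)) b : ℚ) *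
      (((g⁻¹ : GL (Fin n) ℤ) : Matrix (Fin n) (Fin n) ℤ) b (ψ (Sum.inr (m s))) : ℚ) := by
    have : ∀ s : S₁, ∑ b : Fin n,
      ((g : Matrix (Fin n) (Fin n) ℤ) (ψ (Sum.inl s)) b : ℚ) *
      (((g⁻¹ : GL (Fin n) ℤ) : Matrix (Fin n) (Fin n) ℤ) b (ψ (Sum.inr (m s))) : ℚ) =
        if ψ (Sum.inl s) = ψ (Sum.inr (m s)) then 1 else 0 := by
      intro s
      have h1 : (g : Matrix (Fin n) (Fin n) ℤ) * ((g⁻¹ : GL (Fin n) ℤ) : Matrix (Fin n) (Fin n) ℤ) = 1 :=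
        g.mul_inv
      have h2 := congrFun (congrFun h1 (ψ (Sum.inl s))) (ψ (Sum.inr (m s)))
      rw [Matrix.mul_apply, Matrix.one_apply] at h2
      exact_mod_cast congrArg (Int.cast : ℤ → ℚ) h2
    simp only [this, omegaM]
    rw [Finset.prod_ite_zero]
    simp
  rw [hprod, Finset.prod_univ_sum, Fintype.piFinset_univ]
  symm
  refine Finset.sum_of_injOn (fun φ : S₁ → Fin n => (Sum.elim φ (φ ∘ m.symm) : S₁ ⊕ S₂ → Fin n))
    ?_ ?_ ?_ ?_
  · intro φ _ φ' _ h
    funext s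
    exact congrFun h (Sum.inl s)
  · intro φ _; simp
  · intro χ _ hχ
    rw [omegaM, if_neg, mul_zero]
    intro hcon
    apply hχ
    refine ⟨χ ∘ Sum.inl, by simp, ?_⟩
    funext x
    cases x with
    | inl s => rfl
    | inr t => simp [hcon]
  · intro φ _
    simp only [omegaM, Sum.elim_inl, Sum.elim_inr, Function.comp_apply, Equiv.symm_apply_apply,
      implies_true, if_true, mul_one]
    rw [Finset.prod_mul_distrib]
    congr 1
    rw [← Equiv.prod_comp m]
    simp

theorem s4_omega_eval (n : ℕ) {S₁ S₂ : Type} [Fintype S₁] [Fintype S₂]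
    [DecidableEq S₁] [DecidableEq S₂] (m m' : S₁ ≃ S₂) (ι : S₁ → Fin n)
    (hι : Function.Injective ι) :
    omegaM n m (Sum.elim ι (ι ∘ m'.symm)) = if m = m' then 1 else 0 := by
  simp only [omegaM, Sum.elim_inl, Sum.elim_inr, Function.comp_apply]
  congr 1
  rw [eq_iff_iff]
  constructor
  · intro h
    ext s
    have := hι (h s)
    rw [Equiv.eq_symm_apply] at this
    exact this.symm
  · rintro rfl s
    simp

theorem s4_lc_eval (n : ℕ) {S₁ S₂ : Type} [Fintype S₁] [Fintype S₂]
    [DecidableEq S₁] [DecidableEq S₂] (c : (S₁ ≃ S₂) →₀ ℚ) (m' : S₁ ≃ S₂) (ι : S₁ → Fin n)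
    (hι : Function.Injective ι) :
    Finsupp.linearCombination ℚ (fun m : S₁ ≃ S₂ => omegaM n m) c
      (Sum.elim ι (ι ∘ m'.symm)) = c m' := by
  rw [Finsupp.linearCombination_apply, Finsupp.sum_fintype _ _ (by simp), Finset.sum_apply]
  simp [s4_omega_eval n _ m' ι hι]

theorem s4_extend (n : ℕ) {S : Type} [Finite S] (ι ι' : S → Fin n)
    (h : Function.Injective ι) (h' : Function.Injective ι') :
    ∃ σ : Equiv.Perm (Fin n), ι' = σ ∘ ι := by
  classical
  let e : {x // x ∈ Set.range ι} ≃ {x // x ∈ Set.range ι'} :=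
    (Equiv.ofInjective ι h).symm.trans (Equiv.ofInjective ι' h')
  refine ⟨e.extendSubtype, ?_⟩
  funext s
  rw [Function.comp_apply, Equiv.extendSubtype_apply_of_mem _ _ ⟨s, rfl⟩]
  have : (Equiv.ofInjective ι h).symm ⟨ι s, ⟨s, rfl⟩⟩ = s := Equiv.ofInjective_symm_apply h s
  simp [e, this]

theorem statement_4 (n : ℕ) (hn : 0 < n) (S₁ S₂ : Type)
    [Fintype S₁] [Fintype S₂] [DecidableEq S₁] [DecidableEq S₂]
    (hcard : Fintype.card S₁ + Fintype.card S₂ + 3 ≤ n) :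
    Function.Injective
      (Finsupp.linearCombination ℚ (fun m : S₁ ≃ S₂ => omegaM n m)) ∧
    LinearMap.range (Finsupp.linearCombination ℚ (fun m : S₁ ≃ S₂ => omegaM n m)) =
      glInvariants n S₁ S₂ ∧
    (∀ p : ℕ, Fintype.card S₁ = p → Fintype.card S₂ = p →
      (LinearIndependent ℚ (fun m : S₁ ≃ S₂ => omegaM n m) ∧
       Module.finrank ℚ ↥(glInvariants n S₁ S₂) = Nat.factorial p)) := by
  obtain ⟨ι⟩ : Nonempty (S₁ ↪ Fin n) :=
    Function.Embedding.nonempty_of_card_le (by simp; omega)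
  have hinj : Function.Injective
      (Finsupp.linearCombination ℚ (fun m : S₁ ≃ S₂ => omegaM n m)) := by
    intro c c' h
    ext m
    rw [← s4_lc_eval n c m ι ι.injective, h, s4_lc_eval n c' m ι ι.injective]
  have hle : LinearMap.range (Finsupp.linearCombination ℚ (fun m : S₁ ≃ S₂ => omegaM n m)) ≤
      glInvariants n S₁ S₂ := by
    rw [Finsupp.range_linearCombination, Submodule.span_le]
    rintro _ ⟨m, rfl⟩
    exact s4_omega_inv n m
  have hrange : LinearMap.range (Finsupp.linearCombination ℚ (fun m : S₁ ≃ S₂ => omegaM n m)) =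
      glInvariants n S₁ S₂ := by
    refine le_antisymm hle fun T hT => ?_
    let c : (S₁ ≃ S₂) →₀ ℚ := Finsupp.equivFunOnFinite.symm
      (fun m => T (Sum.elim ι (ι ∘ m.symm)))
    refine ⟨c, ?_⟩
    symm
    rw [← sub_eq_zero]
    refine s4_vanish n (by omega) (Submodule.sub_mem _ hT (hle ⟨c, rfl⟩)) ?_
    intro m ι' hι'
    rw [Pi.sub_apply, s4_lc_eval n c m ι' hι']
    obtain ⟨σ, rfl⟩ := s4_extend n ι ι' ι.injective hι'
    have := s4_perm n hT σ (Sum.elim ι (ι ∘ m.symm))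
    rw [Sum.comp_elim] at this
    change T (Sum.elim (σ ∘ ι) (σ ∘ (ι ∘ m.symm))) - _ = 0
    rw [this]
    simp [c]
  refine ⟨hinj, hrange, fun p h1 h2 => ⟨hinj, ?_⟩⟩
  rw [← hrange, LinearMap.finrank_range_of_inj hinj, Module.finrank_finsupp_self,
    Fintype.card_equiv (Fintype.equivOfCardEq (h1.trans h2.symm)), h1]
end
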